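/- There is a constant C > 0, depending only on Q, such that every null-homotopic word w over Q satisfies FFFL(w) ≤ C·ℓ(w): the length-one sequence (w) can be converted to a sequence of empty words by free reductions, free expansions, applications of relators of Q, cyclic conjugations and fragmentations, with the total length of every intermediate sequence of words at most C·ℓ(w). -/

import Mathlib

/-! Words over an alphabet `A`: a letter `(x, true)` is the generator `x`,
and `(x, false)` is its formal inverse `x⁻¹`. -/

/-- A word over the alphabet `A ∪ A⁻¹`. -/
abbrev Word (A : Type*) := List (A × Bool)

namespace Word

/-- The formal inverse of a word. -/
def inv {A : Type*} (w : Word A) : Word A := (w.map fun p => (p.1, !p.2)).reverse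

/-- `w'` is a cyclic conjugate (cyclic permutation) of `w`. -/
def IsCyclicConj {A : Type*} (w w' : Word A) : Prop :=
  ∃ u v : Word A, w = u ++ v ∧ w' = v ++ u

end Word

/-- Moves (i)–(iii) on words with respect to a set `R` of relator words:
free reduction, free expansion, and application of a relator (replace a subword `u`
by `v` where some cyclic conjugate of `u * v⁻¹` lies in `R ∪ R⁻¹`). -/
inductive Move {A : Type*} (R : Set (Word A)) : Word A → Word A → Prop
  | freeReduce (u v : Word A) (x : A) (b : Bool) :
      Move R (u ++ (x, b) :: (x, !b) :: v) (u ++ v)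
  | freeExpand (u v : Word A) (x : A) (b : Bool) :
      Move R (u ++ v) (u ++ (x, b) :: (x, !b) :: v)
  | relator (p q u v z : Word A)
      (hz : Word.IsCyclicConj (u ++ Word.inv v) z) (hR : z ∈ R ∨ Word.inv z ∈ R) :
      Move R (p ++ u ++ q) (p ++ v ++ q)

/-- Moves (i)–(iv): moves (i)–(iii) together with cyclic conjugation. -/
inductive MoveC {A : Type*} (R : Set (Word A)) : Word A → Word A → Prop
  | of {w w' : Word A} : Move R w w' → MoveC R w w'
  | cyc {w w' : Word A} : Word.IsCyclicConj w w' → MoveC R w w'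

/-- Moves (i)–(v) on finite sequences of words: one of the moves (i)–(iv) applied to
one word of the sequence, or fragmentation of one word `u ++ v` into `u` and `v`. -/
inductive MoveF {A : Type*} (R : Set (Word A)) : List (Word A) → List (Word A) → Prop
  | of (l₁ l₂ : List (Word A)) {w w' : Word A} :
      MoveC R w w' → MoveF R (l₁ ++ w :: l₂) (l₁ ++ w' :: l₂)
  | frag (l₁ l₂ : List (Word A)) (u v : Word A) :
      MoveF R (l₁ ++ (u ++ v) :: l₂) (l₁ ++ u :: v :: l₂)

/-- A word is null-homotopic over the presentation with relator set `R` if it represents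
the identity of the presented group, i.e. lies in the normal closure of the relators. -/
def NullHomotopic {A : Type*} (R : Set (Word A)) (w : Word A) : Prop :=
  FreeGroup.mk w ∈ Subgroup.normalClosure (FreeGroup.mk '' R)

/-- `FLle R w L`: the word `w` can be converted to the empty word by moves (i)–(iii)
with every intermediate word of length at most `L`. -/
def FLle {A : Type*} (R : Set (Word A)) (w : Word A) (L : ℕ) : Prop :=
  ∃ (m : ℕ) (f : ℕ → Word A), f 0 = w ∧ f m = [] ∧
    (∀ i < m, Move R (f i) (f (i + 1))) ∧ ∀ i ≤ m, (f i).length ≤ L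

/-- `FFLle R w L`: the word `w` can be converted to the empty word by moves (i)–(iv)
with every intermediate word of length at most `L`. -/
def FFLle {A : Type*} (R : Set (Word A)) (w : Word A) (L : ℕ) : Prop :=
  ∃ (m : ℕ) (f : ℕ → Word A), f 0 = w ∧ f m = [] ∧
    (∀ i < m, MoveC R (f i) (f (i + 1))) ∧ ∀ i ≤ m, (f i).length ≤ L

/-- The total length of a finite sequence of words. -/
def totalLength {A : Type*} (l : List (Word A)) : ℕ := (l.map List.length).sum

/-- `FFFLle R w L`: the length-one sequence `(w)` can be converted to a sequence of empty
words by moves (i)–(v) with every intermediate sequence of total length at most `L`. -/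
def FFFLle {A : Type*} (R : Set (Word A)) (w : Word A) (L : ℕ) : Prop :=
  ∃ (m : ℕ) (f : ℕ → List (Word A)), f 0 = [w] ∧ (∀ u ∈ f m, u = ([] : Word A)) ∧
    (∀ i < m, MoveF R (f i) (f (i + 1))) ∧ ∀ i ≤ m, totalLength (f i) ≤ L

/-- An element `x` of the free group is a conjugate of a relator of `R` or of an inverse
of a relator. -/
def IsConjRelator {A : Type*} (R : Set (Word A)) (x : FreeGroup A) : Prop :=
  ∃ c ρ : FreeGroup A, (ρ ∈ FreeGroup.mk '' R ∨ ρ⁻¹ ∈ FreeGroup.mk '' R) ∧ x = c * ρ * c⁻¹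

/-- `AreaLe R g N`: in the free group, `g` is a product of at most `N` conjugates
of elements of `R ∪ R⁻¹`. -/
def AreaLe {A : Type*} (R : Set (Word A)) (g : FreeGroup A) (N : ℕ) : Prop :=
  ∃ l : List (FreeGroup A), l.length ≤ N ∧ (∀ x ∈ l, IsConjRelator R x) ∧ l.prod = g

/-- The number of occurrences in `w` of the letter `x` or its inverse. -/
def countLtr {A : Type*} [DecidableEq A] (x : A) (w : Word A) : ℕ :=
  (w.filter fun p => p.1 = x).length

/-- The filling length `FL(w)` of a null-homotopic word. -/
noncomputable def FLw {A : Type*} (R : Set (Word A)) (w : Word A) : ℕ :=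
  sInf {L | FLle R w L}

/-- The free filling length `FFL(w)` of a null-homotopic word. -/
noncomputable def FFLw {A : Type*} (R : Set (Word A)) (w : Word A) : ℕ :=
  sInf {L | FFLle R w L}

/-- The fragmenting free filling length `FFFL(w)` of a null-homotopic word. -/
noncomputable def FFFLw {A : Type*} (R : Set (Word A)) (w : Word A) : ℕ :=
  sInf {L | FFFLle R w L}

/-- The filling length function `FL : ℕ → ℕ` of the presentation with relators `R`. -/
noncomputable def FLfn {A : Type*} (R : Set (Word A)) (n : ℕ) : ℕ :=
  sSup (FLw R '' {w | NullHomotopic R w ∧ w.length ≤ n})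

/-- The free filling length function `FFL : ℕ → ℕ`. -/
noncomputable def FFLfn {A : Type*} (R : Set (Word A)) (n : ℕ) : ℕ :=
  sSup (FFLw R '' {w | NullHomotopic R w ∧ w.length ≤ n})

/-- The fragmenting free filling length function `FFFL : ℕ → ℕ`. -/
noncomputable def FFFLfn {A : Type*} (R : Set (Word A)) (n : ℕ) : ℕ :=
  sSup (FFFLw R '' {w | NullHomotopic R w ∧ w.length ≤ n})

/-! The presentation `Q = ⟨a, b, r, s, t | a^b a⁻², [t,a], [r,at], [r,s], [s,t]⟩`. -/

/-- The five generators of the presentation `Q`. -/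
inductive QGen | a | b | r | s | t
deriving DecidableEq

/-- The five relators of `Q`: `b⁻¹aba⁻¹a⁻¹`, `t⁻¹a⁻¹ta`, `r⁻¹t⁻¹a⁻¹rat`,
`r⁻¹s⁻¹rs`, `s⁻¹t⁻¹st`. -/
def QRels : Set (Word QGen) :=
  { [(QGen.b, false), (QGen.a, true), (QGen.b, true), (QGen.a, false), (QGen.a, false)],
    [(QGen.t, false), (QGen.a, false), (QGen.t, true), (QGen.a, true)],
    [(QGen.r, false), (QGen.t, false), (QGen.a, false), (QGen.r, true), (QGen.a, true),
      (QGen.t, true)],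
    [(QGen.r, false), (QGen.s, false), (QGen.r, true), (QGen.s, true)],
    [(QGen.s, false), (QGen.t, false), (QGen.s, true), (QGen.t, true)] }

/-- The word `bⁿ`. -/
def bpow (n : ℕ) : Word QGen := List.replicate n (QGen.b, true)

/-- The word `b⁻ⁿ`. -/
def bpowInv (n : ℕ) : Word QGen := List.replicate n (QGen.b, false)

/-- The word `a^{-bⁿ} = b⁻ⁿ a⁻¹ bⁿ`. -/
def aConjNeg (n : ℕ) : Word QGen := bpowInv n ++ [(QGen.a, false)] ++ bpow n

/-- The word `a^{bⁿ} = b⁻ⁿ a bⁿ`. -/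
def aConjPos (n : ℕ) : Word QGen := bpowInv n ++ [(QGen.a, true)] ++ bpow n

/-- The word `a^{-bⁿ} r a^{bⁿ}`. -/
def gword (n : ℕ) : Word QGen := aConjNeg n ++ [(QGen.r, true)] ++ aConjPos n

/-- The word `w_n = [s, a^{-bⁿ} r a^{bⁿ}] = s⁻¹ (b⁻ⁿa⁻¹bⁿ r b⁻ⁿabⁿ)⁻¹ s (b⁻ⁿa⁻¹bⁿ r b⁻ⁿabⁿ)`. -/
def wn (n : ℕ) : Word QGen :=
  [(QGen.s, false)] ++ Word.inv (gword n) ++ [(QGen.s, true)] ++ gword n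

/-- The word `a^{-bⁿ} r a^{bⁿ} r a^{bⁿ} r⁻¹ a^{-bⁿ}`. -/
def g'word (n : ℕ) : Word QGen :=
  aConjNeg n ++ [(QGen.r, true)] ++ aConjPos n ++ [(QGen.r, true)] ++ aConjPos n ++
    [(QGen.r, false)] ++ aConjNeg n

/-- The word `w'_n = [s, a^{-bⁿ} r a^{bⁿ} r a^{bⁿ} r⁻¹ a^{-bⁿ}]`. -/
def w'n (n : ℕ) : Word QGen :=
  [(QGen.s, false)] ++ Word.inv (g'word n) ++ [(QGen.s, true)] ++ g'word n

/-! ### Fillings of a single word -/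

section Fillings

variable {A : Type*} {R : Set (Word A)}

theorem Word.inv_append (u v : Word A) : Word.inv (u ++ v) = Word.inv v ++ Word.inv u := by
  simp [Word.inv]

theorem Word.inv_inv (u : Word A) : Word.inv (Word.inv u) = u := by
  simp [Word.inv, Function.comp_def]

theorem Word.length_inv (u : Word A) : (Word.inv u).length = u.length := by
  simp [Word.inv]

theorem Word.inv_cons (x : A × Bool) (u : Word A) :
    Word.inv (x :: u) = Word.inv u ++ [(x.1, !x.2)] := by
  simp [Word.inv]

theorem Word.inv_nil : Word.inv ([] : Word A) = [] := rfl

theorem Move.symm {w w' : Word A} (h : Move R w w') : Move R w' w := by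
  cases h with
  | freeReduce u v x b => exact .freeExpand u v x b
  | freeExpand u v x b => exact .freeReduce u v x b
  | relator p q u v z hz hR =>
    obtain ⟨c, d, hcd, rfl⟩ := hz
    refine .relator p q v u (Word.inv (d ++ c)) ⟨Word.inv d, Word.inv c, ?_, ?_⟩ ?_
    · rw [← Word.inv_append, ← hcd, Word.inv_append, Word.inv_inv]
    · rw [Word.inv_append]
    · rw [Word.inv_inv]
      exact hR.symm

theorem Move.append {w w' : Word A} (h : Move R w w') (p q : Word A) :
    Move R (p ++ w ++ q) (p ++ w' ++ q) := by
  cases h with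
  | freeReduce u v x b => simpa using Move.freeReduce (R := R) (p ++ u) (v ++ q) x b
  | freeExpand u v x b => simpa using Move.freeExpand (R := R) (p ++ u) (v ++ q) x b
  | relator p' q' u v z hz hR =>
    simpa using Move.relator (R := R) (p ++ p') (q' ++ q) u v z hz hR

/-- `Homotopic R L w w'`: the word `w` can be converted to `w'` by moves (i)–(iii) through
words of length at most `L`. -/
def Homotopic (R : Set (Word A)) (L : ℕ) : Word A → Word A → Prop :=
  Relation.ReflTransGen fun x y => x.length ≤ L ∧ y.length ≤ L ∧ Move R x y

namespace Homotopic

variable {L M : ℕ} {u v w : Word A}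

theorem refl (L : ℕ) (w : Word A) : Homotopic R L w w := Relation.ReflTransGen.refl

theorem trans (h : Homotopic R L u v) (h' : Homotopic R L v w) : Homotopic R L u w :=
  Relation.ReflTransGen.trans h h'

theorem symm (h : Homotopic R L u v) : Homotopic R L v u := by
  induction h with
  | refl => exact refl _ _
  | tail _ h ih => exact trans (.single ⟨h.2.1, h.1, h.2.2.symm⟩) ih

theorem mono (h : Homotopic R M u v) (hL : M ≤ L) : Homotopic R L u v :=
  Relation.ReflTransGen.mono (fun _ _ h => ⟨h.1.trans hL, h.2.1.trans hL, h.2.2⟩) _ _ h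

theorem append (h : Homotopic R M u v) (p q : Word A) (hL : p.length + M + q.length ≤ L) :
    Homotopic R L (p ++ u ++ q) (p ++ v ++ q) := by
  refine Relation.ReflTransGen.lift (fun w => p ++ w ++ q) ?_ _ _ h
  rintro x y ⟨hx, hy, hm⟩
  refine ⟨?_, ?_, hm.append p q⟩ <;> simp only [List.length_append] <;> omega

/-- Replace a subword by a homotopic one, and continue from there. -/
theorem subst (p q : Word A) {u' v' w' : Word A} (h : Homotopic R M u v)
    (hL : p.length + M + q.length ≤ L) (hu : u' = p ++ u ++ q) (hv : v' = p ++ v ++ q)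
    (h' : Homotopic R L v' w') : Homotopic R L u' w' := by
  subst hu hv
  exact (h.append p q hL).trans h'

theorem of_move (h : Move R u v) (hu : u.length ≤ L) (hv : v.length ≤ L) :
    Homotopic R L u v :=
  .single ⟨hu, hv, h⟩

/-- Two words that form a relator after inverting the second one are homotopic. -/
theorem of_relator (c d : Word A) (h : u ++ Word.inv v = c ++ d) (hR : d ++ c ∈ R)
    (hu : u.length ≤ L) (hv : v.length ≤ L) : Homotopic R L u v := by
  have := Move.relator (R := R) [] [] u v _ ⟨c, d, h, rfl⟩ (.inl hR)
  simp only [List.nil_append, List.append_nil] at this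
  exact of_move this hu hv

theorem append_inv (u : Word A) (hL : 2 * u.length ≤ L) :
    Homotopic R L (u ++ Word.inv u) [] := by
  induction u using List.reverseRecOn with
  | nil => exact refl _ _
  | append_singleton u x ih =>
    simp only [List.length_append, List.length_singleton] at hL
    refine trans (of_move (v := u ++ Word.inv u) ?_ ?_ ?_) (ih (by omega))
    rotate_left
    · simp only [List.length_append, Word.length_inv, List.length_singleton]
      omega
    · simp only [List.length_append, Word.length_inv]
      omega
    · have := Move.freeReduce (R := R) u (Word.inv u) x.1 x.2
      simpa [Word.inv_append, Word.inv_cons, Word.inv_nil] using this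

theorem inv_append (u : Word A) (hL : 2 * u.length ≤ L) :
    Homotopic R L (Word.inv u ++ u) [] := by
  have := append_inv (R := R) (L := L) (Word.inv u) (by rwa [Word.length_inv])
  rwa [Word.inv_inv] at this

/-- If `c` and `d` commute, so do `c⁻¹` and `d`. -/
theorem comm_inv {c d : Word A} (h : Homotopic R M (c ++ d) (d ++ c))
    (hL : M + 3 * c.length + d.length ≤ L) :
    Homotopic R L (Word.inv c ++ d) (d ++ Word.inv c) := by
  have hl := Word.length_inv c
  refine subst (Word.inv c ++ d) [] (append_inv c le_rfl).symm
    (by simp; omega) (by simp) rfl ?_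
  refine subst (Word.inv c) (Word.inv c) h.symm (by omega) (by simp) rfl ?_
  exact subst [] (d ++ Word.inv c) (inv_append c le_rfl) (by simp; omega) (by simp) rfl (refl _ _)

end Homotopic

/-- `Fills R L w`: the word `w` can be converted to a sequence of empty words by moves
(i)–(v) within total length `L`, where each fragment is filled before the next one. -/
inductive Fills (R : Set (Word A)) : ℕ → Word A → Prop
  | nil (L : ℕ) : Fills R L []
  | move {L : ℕ} {w w' : Word A} : w.length ≤ L → Move R w w' → Fills R L w' → Fills R L w
  | cyc {L : ℕ} (u v : Word A) : Fills R L (v ++ u) → Fills R L (u ++ v)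
  | frag {L M : ℕ} {u v : Word A} :
      Fills R M u → M + v.length ≤ L → Fills R L v → Fills R L (u ++ v)

/-- The analogue of `FFFLle` for an arbitrary initial sequence of words. -/
def SeqFills (R : Set (Word A)) (L : ℕ) (l : List (Word A)) : Prop :=
  ∃ (m : ℕ) (f : ℕ → List (Word A)), f 0 = l ∧ (∀ u ∈ f m, u = ([] : Word A)) ∧
    (∀ i < m, MoveF R (f i) (f (i + 1))) ∧ ∀ i ≤ m, totalLength (f i) ≤ L

theorem totalLength_append (l l' : List (Word A)) :
    totalLength (l ++ l') = totalLength l + totalLength l' := by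
  simp [totalLength]

theorem totalLength_cons (w : Word A) (l : List (Word A)) :
    totalLength (w :: l) = w.length + totalLength l := by
  simp [totalLength]

theorem totalLength_eq_zero {l : List (Word A)} (h : ∀ u ∈ l, u = []) : totalLength l = 0 := by
  induction l with
  | nil => rfl
  | cons w l ih =>
    simp only [List.mem_cons, forall_eq_or_imp] at h
    simp [totalLength_cons, h.1, ih h.2]

theorem SeqFills.cons {L : ℕ} {l l' : List (Word A)} (hl : totalLength l ≤ L)
    (h : MoveF R l l') (h' : SeqFills R L l') : SeqFills R L l := by
  obtain ⟨m, f, rfl, h1, h2, h3⟩ := h'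
  refine ⟨m + 1, fun i => Nat.casesOn i l f, rfl, h1, ?_, ?_⟩
  · rintro (_ | i) hi
    · exact h
    · exact h2 i (by omega)
  · rintro (_ | i) hi
    · exact hl
    · exact h3 i (by omega)

namespace Fills

variable {L M : ℕ} {u v w : Word A}

theorem length_le (h : Fills R L w) : w.length ≤ L := by
  induction h with
  | nil => simp
  | move h => exact h
  | cyc u v _ ih => simpa [add_comm] using ih
  | frag _ h _ ih _ => simp only [List.length_append]; omega

theorem seqFills (h : Fills R M w) {l₂ : List (Word A)} (hL : M + totalLength l₂ ≤ L)
    (h₂ : ∀ l₁ : List (Word A), (∀ u ∈ l₁, u = []) → SeqFills R L (l₁ ++ l₂))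
    (l₁ : List (Word A)) (hl₁ : ∀ u ∈ l₁, u = []) : SeqFills R L (l₁ ++ w :: l₂) := by
  have key {x : Word A} {l : List (Word A)} (hx : x.length + totalLength l ≤ L)
      {l₁ : List (Word A)} (hl₁ : ∀ u ∈ l₁, u = []) : totalLength (l₁ ++ x :: l) ≤ L := by
    rw [totalLength_append, totalLength_cons, totalLength_eq_zero hl₁]
    omega
  induction h generalizing L l₁ l₂ with
  | nil =>
    have := h₂ (l₁ ++ [[]]) (by simpa [or_imp, forall_and] using hl₁)
    simpa using this
  | @move M w w' h hm _ ih =>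
    exact SeqFills.cons (key (by omega) hl₁) (.of l₁ l₂ (.of hm)) (ih hL h₂ l₁ hl₁ key)
  | cyc u v h ih =>
    refine SeqFills.cons (key ?_ hl₁) (.of l₁ l₂ (.cyc ⟨u, v, rfl, rfl⟩)) (ih hL h₂ l₁ hl₁ key)
    have := h.length_le
    simp only [List.length_append] at this ⊢
    omega
  | frag hu h hv ihu ihv =>
    have := hu.length_le
    refine SeqFills.cons (key ?_ hl₁) (.frag l₁ l₂ _ _) (ihu ?_ ?_ l₁ hl₁ key)
    · simp only [List.length_append]
      omega
    · simp only [totalLength_cons]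
      omega
    · exact fun l₁ hl₁ => ihv hL h₂ l₁ hl₁ key

theorem fFFLle (h : Fills R L w) : FFFLle R w L := by
  refine h.seqFills (l₂ := []) (by simp [totalLength]) (fun l₁ hl₁ => ?_) [] (by simp)
  refine ⟨0, fun _ => l₁, by simp, hl₁, by simp, fun _ _ => ?_⟩
  simp [totalLength_eq_zero hl₁]

theorem of_homotopic (h : Homotopic R L w v) (hv : Fills R L v) : Fills R L w := by
  induction h using Relation.ReflTransGen.head_induction_on with
  | refl => exact hv
  | head h _ ih => exact .move h.1 h.2.2 ih

/-- Replace a subword by a homotopic one. -/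
theorem subst (p q : Word A) {u' v' : Word A} (h : Homotopic R M u v)
    (hL : p.length + M + q.length ≤ L) (hu : u' = p ++ u ++ q) (hv : v' = p ++ v ++ q)
    (h' : Fills R L v') : Fills R L u' := by
  subst hu hv
  exact of_homotopic (h.append p q hL) h'

/-- Cyclically permute a word. -/
theorem rotate (p q : Word A) {u' v' : Word A} (hu : u' = p ++ q) (hv : v' = q ++ p)
    (h : Fills R L v') : Fills R L u' := by
  subst hu hv
  exact .cyc _ _ h

/-- Replace a subword `u` by a word `v` for which `u v⁻¹` can be filled separately. -/
theorem replace {p q : Word A} (h : Fills R M (u ++ Word.inv v))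
    (hL : p.length + q.length + v.length + M ≤ L) (h' : Fills R L (p ++ v ++ q)) :
    Fills R L (p ++ u ++ q) := by
  have hl := h.length_le
  simp only [List.length_append, Word.length_inv] at hl
  refine subst (p ++ u) q (Homotopic.inv_append v le_rfl).symm ?_ (by simp) rfl ?_
  · simp only [List.length_append]
    omega
  refine rotate p (u ++ Word.inv v ++ (v ++ q)) (by simp) rfl ?_
  rw [List.append_assoc _ (v ++ q)]
  refine .frag h ?_ ?_
  · simp only [List.length_append]
    omega
  · exact rotate (v ++ q) p rfl (by simp) h'

end Fills

end Fillings

/-! ### Short words for powers of `a` -/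

/-- The words `c` and `d` commute, through words of length at most `L`. -/
abbrev Commutes (L : ℕ) (c d : Word QGen) : Prop := Homotopic QRels L (c ++ d) (d ++ c)

namespace Commutes

variable {L M : ℕ} {c d v : Word QGen}

theorem append_left (hc : Commutes M c v) (hd : Commutes M d v)
    (hL : M + c.length + d.length ≤ L) : Commutes L (c ++ d) v := by
  refine Homotopic.subst c [] hd (by simp; omega) (by simp) rfl ?_
  exact Homotopic.subst [] d hc (by simp; omega) (by simp) (by simp) (.refl _ _)

theorem append_right (hc : Commutes M v c) (hd : Commutes M v d)
    (hL : M + c.length + d.length ≤ L) : Commutes L v (c ++ d) :=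
  (append_left hc.symm hd.symm hL).symm

theorem letter_left {x : QGen} (h : Commutes M [(x, true)] v) (hL : M + v.length + 3 ≤ L)
    (e : Bool) : Commutes L [(x, e)] v := by
  cases e with
  | true => exact h.mono (by omega)
  | false => exact Homotopic.comm_inv h (by simp; omega)

theorem letters {x y : QGen} (h : Commutes 2 [(x, true)] [(y, true)]) (d e : Bool) :
    Commutes 10 [(x, d)] [(y, e)] :=
  (letter_left (letter_left h (L := 6) (by simp) d).symm (by simp) e).symm

end Commutes

theorem commutes_t_a (d e : Bool) : Commutes 10 [(.t, d)] [(.a, e)] :=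
  Commutes.letters (Homotopic.of_relator [(.t, true), (.a, true)] [(.t, false), (.a, false)]
    rfl (by simp [QRels]) (by simp) (by simp)) d e

theorem commutes_s_t (d e : Bool) : Commutes 10 [(.s, d)] [(.t, e)] :=
  Commutes.letters (Homotopic.of_relator [(.s, true), (.t, true)] [(.s, false), (.t, false)]
    rfl (by simp [QRels]) (by simp) (by simp)) d e

theorem commutes_r_s (d e : Bool) : Commutes 10 [(.r, d)] [(.s, e)] :=
  Commutes.letters (Homotopic.of_relator [(.r, true), (.s, true)] [(.r, false), (.s, false)]
    rfl (by simp [QRels]) (by simp) (by simp)) d e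

theorem commutes_self (x : QGen) (d e : Bool) : Commutes 10 [(x, d)] [(x, e)] :=
  Commutes.letters (Homotopic.refl _ _) d e

theorem commutes_at_r (e : Bool) : Commutes 10 [(.a, true), (.t, true)] [(.r, e)] :=
  (Commutes.letter_left (M := 3) (Homotopic.of_relator [(.r, true), (.a, true), (.t, true)]
    [(.r, false), (.t, false), (.a, false)] rfl (by simp [QRels]) (by simp) (by simp))
    (by simp) e).symm

theorem homotopic_cancel {x : QGen} (e : Bool) {L : ℕ} (hL : 2 ≤ L) :
    Homotopic QRels L [(x, e), (x, !e)] [] :=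
  Homotopic.append_inv [(x, e)] (by simpa)

theorem homotopic_cancel' {x : QGen} (e : Bool) {L : ℕ} (hL : 2 ≤ L) :
    Homotopic QRels L [(x, !e), (x, e)] [] := by
  simpa using homotopic_cancel (x := x) (!e) hL

/-- `b⁻¹ a b = a²`, and the inverse of this relation. -/
theorem homotopic_b_conj (e : Bool) :
    Homotopic QRels 15 [(.b, false), (.a, e), (.b, true)] [(.a, e), (.a, e)] := by
  have h : Homotopic QRels 3 [(.b, false), (.a, true), (.b, true)] [(.a, true), (.a, true)] :=
    Homotopic.of_relator [] [(.b, false), (.a, true), (.b, true), (.a, false), (.a, false)]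
      rfl (by simp [QRels]) (by simp) (by simp)
  cases e with
  | true => exact h.mono (by norm_num)
  | false =>
    refine Homotopic.subst [] [(.b, false), (.a, false), (.b, true)]
      (Homotopic.inv_append [(.a, true), (.a, true)] le_rfl).symm
      (by simp) (by simp) rfl ?_
    refine Homotopic.subst [(.a, false), (.a, false)] [(.b, false), (.a, false), (.b, true)]
      h.symm (by simp) (by simp [Word.inv]) rfl ?_
    exact Homotopic.subst [(.a, false), (.a, false)] []
      (Homotopic.append_inv [(.b, false), (.a, true), (.b, true)] le_rfl)
      (by simp) (by simp [Word.inv]) (by simp) (.refl _ _)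

theorem homotopic_a_sq (e : Bool) :
    Homotopic QRels 20 [(.b, true), (.a, e), (.a, e)] [(.a, e), (.b, true)] := by
  refine Homotopic.subst [(.b, true)] [] (homotopic_b_conj e).symm (by simp) (by simp) rfl ?_
  exact Homotopic.subst [] [(.a, e), (.b, true)] (homotopic_cancel (x := .b) true le_rfl)
    (by simp) (by simp) (by simp) (.refl _ _)

/-- A word of logarithmic length representing `aⁿ` (if `e = true`) or `a⁻ⁿ`. -/
def natPow (e : Bool) : ℕ → Word QGen
  | 0 => []
  | n + 1 => (.b, false) :: (natPow e ((n + 1) / 2) ++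
      (.b, true) :: (if (n + 1) % 2 = 1 then [(.a, e)] else []))

theorem natPow_zero (e : Bool) : natPow e 0 = [] := by
  rw [natPow]

theorem natPow_two_mul (e : Bool) {n : ℕ} (hn : n ≠ 0) :
    natPow e (2 * n) = (.b, false) :: (natPow e n ++ [(.b, true)]) := by
  obtain ⟨n, rfl⟩ := Nat.exists_eq_succ_of_ne_zero hn
  rw [show 2 * n.succ = (2 * n + 1) + 1 by omega, natPow,
    show (2 * n + 1 + 1) / 2 = n.succ by omega, if_neg (by omega)]

theorem natPow_two_mul_add_one (e : Bool) (n : ℕ) :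
    natPow e (2 * n + 1) = (.b, false) :: (natPow e n ++ [(.b, true), (.a, e)]) := by
  rw [natPow, show (2 * n + 1) / 2 = n by omega, if_pos (by omega)]

theorem Nat.size_two_mul {n : ℕ} (hn : n ≠ 0) : Nat.size (2 * n) = Nat.size n + 1 := by
  have := Nat.size_bit (b := false) (n := n) (by simpa [Nat.bit] using hn)
  simpa [Nat.bit] using this

theorem Nat.size_two_mul_add_one (n : ℕ) : Nat.size (2 * n + 1) = Nat.size n + 1 := by
  have := Nat.size_bit (b := true) (n := n) (by simp [Nat.bit])
  simpa [Nat.bit] using this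

theorem Nat.size_add_le (m n : ℕ) : Nat.size (m + n) ≤ Nat.size m + Nat.size n := by
  rcases Nat.eq_zero_or_pos m with rfl | hm
  · simp
  rcases Nat.eq_zero_or_pos n with rfl | hn
  · simp
  have hm' := Nat.size_pos.2 hm
  have hn' := Nat.size_pos.2 hn
  rw [Nat.size_le]
  have h1 := m.lt_size_self
  have h2 := n.lt_size_self
  rw [pow_add]
  have h3 : 2 ≤ 2 ^ m.size := by simpa using Nat.pow_le_pow_right (n := 2) (by norm_num) hm'
  have h4 : 2 ≤ 2 ^ n.size := by simpa using Nat.pow_le_pow_right (n := 2) (by norm_num) hn'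
  nlinarith

theorem length_natPow_le (e : Bool) (n : ℕ) : (natPow e n).length ≤ 3 * n.size := by
  induction n using Nat.strong_induction_on with
  | _ n ih =>
    rcases Nat.even_or_odd' n with ⟨k, rfl | rfl⟩
    · rcases Nat.eq_zero_or_pos k with rfl | hk
      · simp [natPow_zero]
      · have := ih k (by omega)
        rw [natPow_two_mul e hk.ne', Nat.size_two_mul hk.ne']
        simp
        omega
    · have := ih k (by omega)
      rw [natPow_two_mul_add_one, Nat.size_two_mul_add_one]
      simp
      omega

theorem homotopic_natPow_two_mul (e : Bool) (n : ℕ) {L : ℕ} (hL : 2 ≤ L) :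
    Homotopic QRels L ((.b, false) :: (natPow e n ++ [(.b, true)])) (natPow e (2 * n)) := by
  rcases Nat.eq_zero_or_pos n with rfl | hn
  · simpa [natPow_zero] using homotopic_cancel false hL
  · rw [natPow_two_mul e hn.ne']
    exact .refl _ _

theorem homotopic_natPow_succ (e : Bool) (n : ℕ) {L : ℕ} (hL : 3 * n.size + 30 ≤ L) :
    Homotopic QRels L (natPow e n ++ [(.a, e)]) (natPow e (n + 1)) := by
  induction n using Nat.strong_induction_on generalizing L with
  | _ n ih =>
    rcases Nat.even_or_odd' n with ⟨k, rfl | rfl⟩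
    · rw [natPow_two_mul_add_one]
      exact Homotopic.subst [] [(.a, e)] (homotopic_natPow_two_mul e k le_rfl).symm
        (by simp; omega) (by simp) (by simp) (.refl _ _)
    · have hk := length_natPow_le e k
      rw [Nat.size_two_mul_add_one] at hL
      rw [natPow_two_mul_add_one]
      refine Homotopic.subst ((.b, false) :: natPow e k) [] (homotopic_a_sq e)
        (by simp; omega) (by simp) rfl ?_
      refine Homotopic.subst [(.b, false)] [(.b, true)] (ih k (by omega) le_rfl)
        (by simp; omega) (by simp) rfl ?_
      exact homotopic_natPow_two_mul e (k + 1) (by omega)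

/-! ### Integer powers -/

/-- The sign of a letter. -/
def sgn (e : Bool) : ℤ := if e then 1 else -1

theorem sgn_not (e : Bool) : sgn (!e) = -sgn e := by
  cases e <;> rfl

/-- Extend a family of words representing the powers `xⁿ` and `x⁻ⁿ` to integer exponents. -/
def intPow (P : Bool → ℕ → Word QGen) (k : ℤ) : Word QGen := P (decide (0 ≤ k)) k.natAbs

theorem exists_intPow_eq {P : Bool → ℕ → Word QGen} (k : ℤ) :
    ∃ e, intPow P k = P e k.natAbs ∧ k = sgn e * k.natAbs := by
  refine ⟨_, rfl, ?_⟩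
  by_cases hk : 0 ≤ k
  · simp [sgn, hk, abs_of_nonneg]
  · simp [sgn, hk, abs_of_neg (not_le.1 hk)]

theorem intPow_sgn_mul {P : Bool → ℕ → Word QGen} (h0 : ∀ e, P e 0 = []) (e : Bool) (n : ℕ) :
    intPow P (sgn e * n) = P e n := by
  rcases Nat.eq_zero_or_pos n with rfl | hn
  · simp [intPow, h0]
  · cases e
    · simp [intPow, sgn, hn.ne']
    · simp [intPow, sgn]

theorem homotopic_intPow_add_sgn {P : Bool → ℕ → Word QGen} {x : QGen} {L M : ℕ}
    (h0 : ∀ e, P e 0 = []) (k : ℤ)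
    (h : ∀ e, ∀ n ≤ k.natAbs, Homotopic QRels M (P e n ++ [(x, e)]) (P e (n + 1)))
    (hP : ∀ e, ∀ n ≤ k.natAbs, (P e n).length + 2 ≤ L) (hL : M + 1 ≤ L) (e : Bool) :
    Homotopic QRels L (intPow P k ++ [(x, e)]) (intPow P (k + sgn e)) := by
  obtain ⟨d, hd, hk⟩ := exists_intPow_eq (P := P) k
  rw [hd]
  by_cases hde : d = e
  · subst hde
    rw [show k + sgn d = sgn d * (k.natAbs + 1 : ℕ) by
      rw [Nat.cast_add, mul_add, ← hk, Nat.cast_one, mul_one],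
      intPow_sgn_mul h0]
    exact (h d _ le_rfl).mono (by omega)
  · obtain rfl : e = !d := (Bool.eq_not_of_ne (Ne.symm hde))
    rcases hn : k.natAbs with _ | n
    · have := h (!d) 0 (by omega)
      simp only [h0, List.nil_append, zero_add] at this ⊢
      rw [show k + sgn (!d) = sgn (!d) * (1 : ℕ) by
        rw [Int.natAbs_eq_zero.1 hn, zero_add, Nat.cast_one, mul_one], intPow_sgn_mul h0]
      exact this.mono (by omega)
    · have hk' : k + sgn (!d) = sgn d * n := by
        rw [hk, sgn_not, hn]
        push_cast
        ring
      rw [hk', intPow_sgn_mul h0]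
      refine Homotopic.subst [] [(x, !d)] (h d n (by omega)).symm (by simp; omega)
        (by simp) rfl ?_
      exact Homotopic.subst (P d n) [] (homotopic_cancel (x := x) d le_rfl)
        (by simpa using hP d n (by omega)) (by simp) (by simp) (.refl _ _)

/-- A word of logarithmic length representing `aⁿ`. -/
def aPow (n : ℤ) : Word QGen := intPow natPow n

/-- The word `tⁿ`. -/
def tPow (n : ℤ) : Word QGen := intPow (fun e n => List.replicate n (.t, e)) n

/-- The number of binary digits of `|n|`. -/
def bitLen (n : ℤ) : ℕ := n.natAbs.size

theorem bitLen_neg (n : ℤ) : bitLen (-n) = bitLen n := by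
  simp [bitLen]

theorem bitLen_le {m n : ℤ} (h : m.natAbs ≤ n.natAbs) : bitLen m ≤ bitLen n :=
  Nat.size_le_size h

theorem bitLen_le_size {m : ℤ} {N : ℕ} (h : m.natAbs ≤ N) : bitLen m ≤ N.size :=
  Nat.size_le_size h

theorem bitLen_add_le (m n : ℤ) : bitLen (m + n) ≤ bitLen m + bitLen n :=
  (Nat.size_le_size (Int.natAbs_add_le m n)).trans (Nat.size_add_le _ _)

theorem bitLen_two_mul_le (n : ℤ) : bitLen (2 * n) ≤ bitLen n + 1 := by
  by_cases hn : n = 0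
  · simp [hn, bitLen]
  · simp [bitLen, Int.natAbs_mul, Nat.size_two_mul (Int.natAbs_ne_zero.2 hn)]

theorem aPow_zero : aPow 0 = [] := natPow_zero _

theorem aPow_sgn_mul (e : Bool) (n : ℕ) : aPow (sgn e * n) = natPow e n :=
  intPow_sgn_mul natPow_zero e n

theorem exists_aPow_eq (n : ℤ) : ∃ e, aPow n = natPow e n.natAbs ∧ n = sgn e * n.natAbs :=
  exists_intPow_eq n

theorem tPow_zero : tPow 0 = [] := rfl

theorem length_aPow_le (n : ℤ) : (aPow n).length ≤ 3 * bitLen n :=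
  length_natPow_le _ _

theorem length_tPow (n : ℤ) : (tPow n).length = n.natAbs := by
  simp [tPow, intPow]

theorem homotopic_aPow_add_sgn (n : ℤ) (e : Bool) {L : ℕ} (hL : 3 * bitLen n + 31 ≤ L) :
    Homotopic QRels L (aPow n ++ [(.a, e)]) (aPow (n + sgn e)) := by
  have hs {k : ℕ} (hk : k ≤ n.natAbs) : k.size ≤ bitLen n := Nat.size_le_size hk
  refine homotopic_intPow_add_sgn (M := 3 * bitLen n + 30) natPow_zero n
    (fun e k hk => homotopic_natPow_succ e k ?_) (fun e k hk => ?_) (by omega) e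
  · have := hs hk
    omega
  · have := hs hk
    have := length_natPow_le e k
    omega

theorem homotopic_tPow_add_sgn (n : ℤ) (e : Bool) {L : ℕ} (hL : n.natAbs + 2 ≤ L) :
    Homotopic QRels L (tPow n ++ [(.t, e)]) (tPow (n + sgn e)) := by
  refine homotopic_intPow_add_sgn (M := 0) (by simp) n (fun e k hk => ?_)
    (fun e k hk => ?_) (by omega) e
  · simp only [List.replicate_succ']
    exact .refl _ _
  · simp
    omega

theorem Homotopic.inv {L M : ℕ} {u v : Word QGen} (h : Homotopic QRels M u v)
    (hL : M + u.length + 3 * v.length ≤ L) :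
    Homotopic QRels L (Word.inv u) (Word.inv v) := by
  have hu := Word.length_inv u
  have hv := Word.length_inv v
  by_cases huv : u = v
  · exact huv ▸ .refl _ _
  have hM : u.length ≤ M := by
    obtain h | ⟨w, h, -⟩ := Relation.ReflTransGen.cases_head h
    · exact absurd h huv
    · exact h.1
  refine subst (Word.inv u) [] (append_inv v le_rfl).symm (by simp; omega) (by simp) rfl ?_
  refine subst (Word.inv u) (Word.inv v) h.symm (by omega) (by simp) rfl ?_
  exact subst [] (Word.inv v) (inv_append u le_rfl) (by simp; omega) (by simp) (by simp)
    (.refl _ _)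

theorem homotopic_inv_natPow_succ (e : Bool) (n : ℕ) {L : ℕ} (hL : 15 * n.size + 60 ≤ L) :
    Homotopic QRels L ((.a, e) :: Word.inv (natPow (!e) n)) (Word.inv (natPow (!e) (n + 1))) := by
  have h1 := length_natPow_le (!e) n
  have h2 := length_natPow_le (!e) (n + 1)
  have h3 := Nat.size_add_le n 1
  rw [Nat.size_one] at h3
  have := (homotopic_natPow_succ (!e) n le_rfl).inv (L := L) (by simp; omega)
  simpa [Word.inv_append, Word.inv_cons, Word.inv_nil] using this

theorem homotopic_natPow_inv (e : Bool) (n : ℕ) {L : ℕ} (hL : 21 * n.size + 70 ≤ L) :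
    Homotopic QRels L (natPow e n) (Word.inv (natPow (!e) n)) := by
  have key (k m : ℕ) (hk : k ≤ n) (hm : m + k = n) :
      Homotopic QRels L (natPow e n) (natPow e m ++ Word.inv (natPow (!e) k)) := by
    induction k generalizing m with
    | zero =>
      subst hm
      simpa [natPow_zero, Word.inv_nil] using Homotopic.refl _ _
    | succ k ih =>
      have h1 := Nat.size_le_size (m := k) (n := n) (by omega)
      have h2 := Nat.size_le_size (m := m) (n := n) (by omega)
      have h3 := length_natPow_le e m
      have h4 := length_natPow_le (!e) k
      refine (ih (m + 1) (by omega) (by omega)).trans ?_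
      refine Homotopic.subst [] (Word.inv (natPow (!e) k)) (homotopic_natPow_succ e m le_rfl).symm
        (by simp [Word.length_inv]; omega) (by simp) rfl ?_
      exact Homotopic.subst (natPow e m) [] (homotopic_inv_natPow_succ e k le_rfl)
        (by simp; omega) (by simp) (by simp) (.refl _ _)
  simpa [natPow_zero] using key n 0 le_rfl (by omega)

theorem homotopic_inv_aPow (n : ℤ) {L : ℕ} (hL : 21 * bitLen n + 70 ≤ L) :
    Homotopic QRels L (Word.inv (aPow n)) (aPow (-n)) := by
  obtain ⟨e, he, hn⟩ := exists_aPow_eq n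
  rw [he, show -n = sgn (!e) * n.natAbs by rw [sgn_not, neg_mul, ← hn], aPow_sgn_mul]
  simpa using (homotopic_natPow_inv (!e) n.natAbs hL).symm

theorem homotopic_natPow_succ' (e : Bool) (n : ℕ) {L : ℕ} (hL : 21 * n.size + 100 ≤ L) :
    Homotopic QRels L ((.a, e) :: natPow e n) (natPow e (n + 1)) := by
  have h := Nat.size_add_le n 1
  rw [Nat.size_one] at h
  refine Homotopic.subst [(.a, e)] [] (homotopic_natPow_inv e n le_rfl) (by simp; omega)
    (by simp) rfl ?_
  refine Homotopic.trans ?_ (homotopic_natPow_inv e (n + 1) (by omega)).symm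
  simpa using homotopic_inv_natPow_succ e n (by omega)

/-- A word commuting with `a` commutes with the powers of `a`. -/
theorem Commutes.aPow_right {M L : ℕ} {y : Word QGen} (hy : Commutes M y [(.a, true)]) (n : ℤ)
    (hL : M + 4 * y.length + 24 * bitLen n + 110 ≤ L) : Commutes L y (aPow n) := by
  obtain ⟨e, he, -⟩ := exists_aPow_eq n
  have hs {k : ℕ} (hk : k ≤ n.natAbs) : k.size ≤ bitLen n := Nat.size_le_size hk
  have hye : Commutes (M + 3 * y.length + 3) y [(.a, e)] :=
    (Commutes.letter_left (L := M + 3 * y.length + 3) hy.symm (by omega) e).symm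
  rw [he]
  have key (k m : ℕ) (hkm : m + k = n.natAbs) :
      Homotopic QRels L (y ++ natPow e n.natAbs) (natPow e k ++ y ++ natPow e m) := by
    induction k generalizing m with
    | zero =>
      simp only [add_zero] at hkm
      simpa [natPow_zero, ← hkm] using Homotopic.refl _ _
    | succ k ih =>
      refine (ih (m + 1) (by omega)).trans ?_
      have h1 := hs (k := k) (by omega)
      have h2 := hs (k := m) (by omega)
      have h3 := length_natPow_le e m
      have h4 := length_natPow_le e k
      refine Homotopic.subst (natPow e k ++ y) [] (homotopic_natPow_succ' e m le_rfl).symm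
        (by simp; omega) (by simp) rfl ?_
      refine Homotopic.subst (natPow e k) (natPow e m) hye
        (by omega) (by simp) rfl ?_
      exact Homotopic.subst [] (y ++ natPow e m) (homotopic_natPow_succ e k le_rfl)
        (by simp; omega) (by simp) (by simp) (.refl _ _)
  simpa [natPow_zero] using key n.natAbs 0 (by omega)

theorem homotopic_aPow_add (m n : ℤ) {L : ℕ} (hL : 24 * (bitLen m + bitLen n) + 110 ≤ L) :
    Homotopic QRels L (aPow m ++ aPow n) (aPow (m + n)) := by
  obtain ⟨e, he, hn⟩ := exists_aPow_eq n
  have key (k : ℕ) (j : ℤ) (hk : k ≤ n.natAbs) (hj : j.natAbs + k ≤ m.natAbs + n.natAbs) :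
      Homotopic QRels L (aPow j ++ natPow e k) (aPow (j + sgn e * k)) := by
    induction k generalizing j with
    | zero => simpa [natPow_zero] using Homotopic.refl _ _
    | succ k ih =>
      have h1 : k.size ≤ bitLen n := Nat.size_le_size (by omega)
      have h2 : bitLen j ≤ bitLen m + bitLen n :=
        (Nat.size_le_size (by omega)).trans (Nat.size_add_le m.natAbs n.natAbs)
      have h3 := length_natPow_le e k
      have h4 := length_aPow_le j
      refine Homotopic.subst (aPow j) [] (homotopic_natPow_succ' e k le_rfl).symm
        (by simp; omega) (by simp) rfl ?_
      refine Homotopic.subst [] (natPow e k) (homotopic_aPow_add_sgn j e le_rfl)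
        (by simp; omega) (by simp) rfl ?_
      have := ih (j + sgn e) (by omega) (by cases e <;> simp only [sgn] <;> simp <;> omega)
      rwa [show j + sgn e + sgn e * k = j + sgn e * (k + 1 : ℕ) by push_cast; ring] at this
  have := key _ m le_rfl le_rfl
  rwa [← he, ← hn] at this

/-- `b⁻¹ aⁿ b = a²ⁿ`. -/
theorem homotopic_b_conj_aPow (n : ℤ) {L : ℕ} (hL : 2 ≤ L) :
    Homotopic QRels L ([(.b, false)] ++ aPow n ++ [(.b, true)]) (aPow (2 * n)) := by
  obtain ⟨e, he, hn⟩ := exists_aPow_eq n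
  rw [he, show 2 * n = sgn e * (2 * n.natAbs : ℕ) by
    rw [Nat.cast_mul, mul_left_comm, ← hn]; rfl,
    aPow_sgn_mul]
  simpa using homotopic_natPow_two_mul e n.natAbs hL

theorem homotopic_b_conj_aPow' (n : ℤ) {L : ℕ} (hL : 3 * bitLen n + 10 ≤ L) :
    Homotopic QRels L ([(.b, true)] ++ aPow (2 * n) ++ [(.b, false)]) (aPow n) := by
  have := length_aPow_le n
  refine Homotopic.subst [(.b, true)] [(.b, false)] (homotopic_b_conj_aPow n le_rfl).symm
    (by simp; omega) rfl rfl ?_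
  refine Homotopic.subst [] (aPow n ++ [(.b, true), (.b, false)])
    (homotopic_cancel (x := .b) true le_rfl) (by simp; omega) (by simp) rfl ?_
  exact Homotopic.subst (aPow n) [] (homotopic_cancel (x := .b) true le_rfl)
    (by simp; omega) (by simp) (by simp) (.refl _ _)

/-! ### Pinches in HNN extensions -/

section Pinch

open HNNExtension HNNExtension.NormalWord

variable {G σ : Type*} [Group G] {A B : Subgroup G} (φ : A ≃* B) (c : σ → G ⊕ ℤˣ)

/-- The element of the HNN extension represented by a list of symbols, each of which stands for
an element of the base group or for a power `t ^ ±1` of the stable letter. -/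
def hnnVal (l : List σ) : HNNExtension G A B φ :=
  (l.map fun x => Sum.elim of (fun u : ℤˣ => t ^ (u : ℤ)) (c x)).prod

/-- The element of the base group represented by a list of symbols, ignoring stable letters. -/
def baseVal (l : List σ) : G := (l.map fun x => Sum.elim id (fun _ => 1) (c x)).prod

variable (A B) in
/-- The list `l` contains `t ^ u * g * t ^ (-u)` with `g` in the subgroup associated with `u`. -/
def HasPinch (l : List σ) : Prop :=
  ∃ p x m y q u, l = p ++ x :: (m ++ y :: q) ∧ c x = .inr u ∧ c y = .inr (-u) ∧
    (∀ z ∈ m, (c z).isLeft) ∧ baseVal c m ∈ toSubgroup A B u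

theorem exists_reducedWord_or_hasPinch (l : List σ) :
    HasPinch A B c l ∨ ∃ w : ReducedWord G A B, w.prod φ = hnnVal φ c l ∧
      (((∀ x ∈ l, (c x).isLeft) ∧ w.toList = [] ∧ baseVal c l = w.head) ∨
        ∃ m y q u g k, l = m ++ y :: q ∧ c y = .inr u ∧ (∀ x ∈ m, (c x).isLeft) ∧
          baseVal c m = w.head ∧ w.toList = (u, g) :: k) := by
  induction l with
  | nil => exact .inr ⟨.empty G A B, by simp [hnnVal, ReducedWord.prod], .inl ⟨by simp, rfl, rfl⟩⟩
  | cons x l ih =>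
    rcases ih with ⟨p, x', m, y, q, u, rfl, h⟩ | ⟨w, hw, h⟩
    · exact .inl ⟨x :: p, x', m, y, q, u, by simp, h⟩
    rcases hx : c x with g | e
    · refine .inr ⟨{ w with head := g * w.head }, ?_, ?_⟩
      · simp [hnnVal, ReducedWord.prod, hx, mul_assoc] at hw ⊢
        rw [← hw]
      · rcases h with ⟨h1, h2, h3⟩ | ⟨m, y, q, u, g', k, rfl, hy, hm, hh, hk⟩
        · exact .inl ⟨by simpa [hx] using h1, h2, by simp [baseVal, hx, ← h3]⟩
        · exact .inr ⟨x :: m, y, q, u, g', k, rfl, hy, by simpa [hx] using hm,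
            by simp [baseVal, hx, ← hh], hk⟩
    · by_cases hc : ((e, w.head) :: w.toList).IsChain
        (fun a b => a.2 ∈ toSubgroup A B a.1 → a.1 = b.1)
      · refine .inr ⟨⟨1, _, hc⟩, ?_, .inr ⟨[], x, l, e, _, _, rfl, hx, by simp, rfl, rfl⟩⟩
        simp [hnnVal, ReducedWord.prod, hx] at hw ⊢
        rw [← hw, mul_assoc]
      · left
        rcases h with ⟨h1, h2, h3⟩ | ⟨m, y, q, u, g', k, rfl, hy, hm, hh, hk⟩
        · simp [h2] at hc
        · have hchain := w.chain
          rw [hk] at hc hchain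
          simp only [List.isChain_cons_cons, hchain, and_true, Classical.not_imp] at hc
          refine ⟨[], x, m, y, q, e, rfl, hx, ?_, hm, hh ▸ hc.1⟩
          rw [hy]
          rcases Int.units_eq_one_or e with rfl | rfl <;>
            rcases Int.units_eq_one_or u with rfl | rfl <;> simp_all

/-- **Britton's Lemma** for lists of symbols. -/
theorem hasPinch_of_hnnVal_eq_one {l : List σ} (h : hnnVal φ c l = 1) :
    HasPinch A B c l ∨ ((∀ x ∈ l, (c x).isLeft) ∧ baseVal c l = 1) := by
  rcases exists_reducedWord_or_hasPinch φ c l with h' | ⟨w, hw, h'⟩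
  · exact .inl h'
  right
  rw [h] at hw
  have hnil := ReducedWord.toList_eq_nil_of_mem_of_range φ w (by rw [hw]; exact one_mem _)
  rcases h' with ⟨h1, h2, h3⟩ | ⟨m, y, q, u, g', k, _, _, _, _, hk⟩
  · refine ⟨h1, h3.trans (of_injective (φ := φ) ?_)⟩
    simpa [ReducedWord.prod, hnil] using hw
  · simp [hnil] at hk

end Pinch

/-! ### Words with compressed powers of `a` -/

/-- The syllables of a compressed word: powers of `a` and the remaining letters. -/
inductive Syl
  | A (n : ℤ)
  | T (e : Bool)
  | R (e : Bool)
  | S (e : Bool)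
  | B (e : Bool)

namespace Syl

/-- The word represented by a syllable. -/
def word : Syl → Word QGen
  | A n => aPow n
  | T e => [(.t, e)]
  | R e => [(.r, e)]
  | S e => [(.s, e)]
  | B e => [(.b, e)]

/-- The weight of a syllable bounds the length of its word up to a constant. -/
def wt : Syl → ℕ
  | A n => bitLen n
  | _ => 1

/-- The exponent of `a`. -/
def expA : Syl → ℤ
  | A n => n
  | _ => 0

/-- The exponent of `t`. -/
def expT : Syl → ℤ
  | T e => sgn e
  | _ => 0

theorem length_word_le (x : Syl) : x.word.length ≤ 3 * x.wt := by
  cases x <;> simp [word, wt, length_aPow_le]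

end Syl

/-- The word represented by a list of syllables. -/
def real (l : List Syl) : Word QGen := l.flatMap Syl.word

/-- The total weight of a list of syllables. -/
def wt (l : List Syl) : ℕ := (l.map Syl.wt).sum

/-- The exponent sum of `a`. -/
def sumA (l : List Syl) : ℤ := (l.map Syl.expA).sum

/-- The exponent sum of `t`. -/
def sumT (l : List Syl) : ℤ := (l.map Syl.expT).sum

/-- The sum of the absolute values of the exponents of `a`. -/
def absA (l : List Syl) : ℕ := (l.map fun x => x.expA.natAbs).sum

section

variable (x : Syl) (l l' : List Syl)

@[simp] theorem real_nil : real [] = [] := rfl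
@[simp] theorem real_cons : real (x :: l) = x.word ++ real l := rfl
@[simp] theorem real_append : real (l ++ l') = real l ++ real l' := by simp [real]
@[simp] theorem wt_nil : wt [] = 0 := rfl
@[simp] theorem wt_cons : wt (x :: l) = x.wt + wt l := rfl
@[simp] theorem wt_append : wt (l ++ l') = wt l + wt l' := by simp [wt]
@[simp] theorem sumA_nil : sumA [] = 0 := rfl
@[simp] theorem sumA_cons : sumA (x :: l) = x.expA + sumA l := rfl
@[simp] theorem sumA_append : sumA (l ++ l') = sumA l + sumA l' := by simp [sumA]
@[simp] theorem sumT_nil : sumT [] = 0 := rfl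
@[simp] theorem sumT_cons : sumT (x :: l) = x.expT + sumT l := rfl
@[simp] theorem sumT_append : sumT (l ++ l') = sumT l + sumT l' := by simp [sumT]
@[simp] theorem absA_nil : absA [] = 0 := rfl
@[simp] theorem absA_cons : absA (x :: l) = x.expA.natAbs + absA l := rfl

theorem length_real_le : (real l).length ≤ 3 * wt l := by
  induction l with
  | nil => simp
  | cons x l ih =>
    have := x.length_word_le
    simp
    omega

theorem natAbs_sumA_le : (sumA l).natAbs ≤ absA l := by
  induction l with
  | nil => simp
  | cons x l ih => simp; omega

theorem size_absA_le : (absA l).size ≤ wt l := by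
  induction l with
  | nil => simp
  | cons x l ih =>
    have := Nat.size_add_le x.expA.natAbs (absA l)
    have : x.expA.natAbs.size ≤ x.wt := by cases x <;> simp [Syl.expA, Syl.wt, bitLen]
    simp
    omega

theorem bitLen_sumA_le : bitLen (sumA l) ≤ wt l :=
  (bitLen_le_size (natAbs_sumA_le l)).trans (size_absA_le l)

theorem natAbs_sumT_le : (sumT l).natAbs ≤ wt l := by
  induction l with
  | nil => simp
  | cons x l ih =>
    have : x.expT.natAbs ≤ x.wt := by
      rcases x with n | e | e | e | e <;> simp [Syl.expT, Syl.wt, sgn]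
      cases e <;> simp
    simp
    omega

end

/-- A word commutes with a concatenation of words if it commutes with each of them. -/
theorem Commutes.flatMap {σ : Type*} {f : σ → Word QGen} {y : Word QGen} {L M : ℕ} {l : List σ}
    (h : ∀ x ∈ l, Commutes M y (f x)) (hL : M + (l.flatMap f).length + y.length ≤ L) :
    Commutes L y (l.flatMap f) := by
  induction l generalizing L with
  | nil =>
    simp only [List.flatMap_nil, Commutes, List.append_nil, List.nil_append]
    exact .refl _ _
  | cons x l ih =>
    simp only [List.mem_cons, forall_eq_or_imp] at h
    simp only [List.flatMap_cons, List.length_append] at hL ⊢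
    refine Homotopic.subst [] (l.flatMap f) h.1
      (by simp only [List.length_nil]; omega) (by simp) rfl ?_
    refine Homotopic.subst (f x) [] (ih h.2 le_rfl)
      (by simp only [List.length_nil]; omega) (by simp) rfl ?_
    simpa using Homotopic.refl _ _

theorem Commutes.tPow_right {y : Word QGen} {L M : ℕ} (h : ∀ e, Commutes M y [(.t, e)]) (n : ℤ)
    (hL : M + n.natAbs + y.length ≤ L) : Commutes L y (tPow n) := by
  have : tPow n = (List.replicate n.natAbs (QGen.t, decide (0 ≤ n))).flatMap ([·]) := by
    simp [tPow, intPow]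
  rw [this]
  refine Commutes.flatMap (M := M) (fun x hx => ?_) (by simpa using hL)
  rw [List.eq_of_mem_replicate hx]
  exact h _

theorem commutes_t_aPow (e : Bool) (n : ℤ) {L : ℕ} (hL : 24 * bitLen n + 124 ≤ L) :
    Commutes L [(.t, e)] (aPow n) :=
  Commutes.aPow_right (commutes_t_a e true) n (by simp; omega)

theorem commutes_aPow_tPow (m n : ℤ) {L : ℕ} (hL : 27 * bitLen m + n.natAbs + 130 ≤ L) :
    Commutes L (aPow m) (tPow n) := by
  have := length_aPow_le m
  exact Commutes.tPow_right (fun e => (commutes_t_aPow e m le_rfl).symm) n (by omega)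

/-- A syllable that is a power of `a` or of `t`. -/
def Syl.IsAT : Syl → Prop
  | A _ => True
  | T _ => True
  | _ => False

/-- A syllable that is a power of `a`, `t` or `r`. -/
def Syl.IsATR : Syl → Prop
  | A _ => True
  | T _ => True
  | R _ => True
  | _ => False

theorem homotopic_real_of_isAT {l : List Syl} (hl : ∀ x ∈ l, x.IsAT) {L : ℕ}
    (hL : 100 * wt l + 200 ≤ L) : Homotopic QRels L (real l) (aPow (sumA l) ++ tPow (sumT l)) := by
  induction l using List.reverseRecOn generalizing L with
  | nil => simpa [aPow_zero, tPow_zero] using Homotopic.refl _ _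
  | append_singleton l x ih =>
    simp only [List.mem_append, List.mem_singleton, or_imp, forall_and, forall_eq] at hl
    simp only [wt_append, wt_cons, wt_nil] at hL
    have h1 := bitLen_sumA_le l
    have h2 := natAbs_sumT_le l
    have h3 := x.length_word_le
    have h4 := length_aPow_le (sumA l)
    have h5 := length_tPow (sumT l)
    refine Homotopic.subst [] x.word (ih hl.1 le_rfl) (by simp; omega) (by simp) rfl ?_
    rcases x with n | e | e | e | e
    · simp only [Syl.word, Syl.wt] at h3 hL ⊢
      refine Homotopic.subst (aPow (sumA l)) []
        (commutes_aPow_tPow n (sumT l) le_rfl).symm (by simp; omega) (by simp) rfl ?_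
      refine Homotopic.subst [] (tPow (sumT l)) (homotopic_aPow_add (sumA l) n le_rfl)
        (by simp; omega) (by simp) rfl ?_
      simpa [Syl.expA, Syl.expT] using Homotopic.refl _ _
    · simp only [Syl.word, Syl.wt] at h3 hL ⊢
      refine Homotopic.subst (aPow (sumA l)) [] (homotopic_tPow_add_sgn (sumT l) e le_rfl)
        (by simp; omega) (by simp) rfl ?_
      simpa [Syl.expA, Syl.expT] using Homotopic.refl _ _
    all_goals exact hl.2.elim

/-! ### The element `x = at` -/

/-- The word `a ^ k * t ^ k`, a power of `x = at`. -/
def xPow (k : ℤ) : Word QGen := aPow k ++ tPow k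

/-- The word `(at) ^ ±1`. -/
def xWord (e : Bool) : Word QGen := [(.a, e), (.t, e)]

theorem length_xPow_le (k : ℤ) : (xPow k).length ≤ 3 * bitLen k + k.natAbs := by
  have := length_aPow_le k
  have := length_tPow k
  simp only [xPow, List.length_append]
  omega

theorem bitLen_le_natAbs (k : ℤ) : bitLen k ≤ k.natAbs :=
  Nat.size_le.2 Nat.lt_two_pow_self

theorem xWord_commutes_letter {y : QGen × Bool} {M L : ℕ} (ha : ∀ e, Commutes M [(.a, e)] [y])
    (ht : ∀ e, Commutes M [(.t, e)] [y]) (e : Bool) (hL : M + 2 ≤ L) : Commutes L (xWord e) [y] :=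
  Commutes.append_left (c := [(.a, e)]) (d := [(.t, e)]) (ha e) (ht e) (by simp; omega)

theorem xWord_commutes_a (e d : Bool) : Commutes 12 (xWord e) [(.a, d)] :=
  xWord_commutes_letter (fun _ => commutes_self _ _ _) (fun _ => commutes_t_a _ _) e le_rfl

theorem xWord_commutes_t (e d : Bool) : Commutes 12 (xWord e) [(.t, d)] :=
  xWord_commutes_letter (fun _ => (commutes_t_a _ _).symm) (fun _ => commutes_self _ _ _) e le_rfl

theorem xWord_commutes_r (e d : Bool) : Commutes 20 (xWord e) [(.r, d)] := by
  cases e with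
  | true => exact (commutes_at_r d).mono (by omega)
  | false =>
    refine Homotopic.subst [] [(.r, d)] (commutes_t_a false false).symm (by simp) rfl rfl ?_
    refine .trans (v := [(.r, d)] ++ [(.t, false), (.a, false)]) ?_ ?_
    · exact Homotopic.comm_inv (commutes_at_r d) (by simp)
    · exact Homotopic.subst [(.r, d)] [] (commutes_t_a false false) (by simp) rfl rfl (.refl _ _)

theorem xWord_commutes_aPow (e : Bool) (n : ℤ) {L : ℕ} (hL : 24 * bitLen n + 130 ≤ L) :
    Commutes L (xWord e) (aPow n) :=
  Commutes.aPow_right (xWord_commutes_a e true) n (by simp [xWord]; omega)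

theorem xWord_commutes_xPow (e : Bool) (n : ℤ) {L : ℕ} (hL : 30 * n.natAbs + 150 ≤ L) :
    Commutes L (xWord e) (xPow n) := by
  have h1 := bitLen_le_natAbs n
  have h2 := length_aPow_le n
  have h3 := length_tPow n
  have h4 : (xWord e).length = 2 := rfl
  exact Commutes.append_right (M := 24 * n.natAbs + 130) (xWord_commutes_aPow e n (by omega))
    (Commutes.tPow_right (xWord_commutes_t e) n (by omega)) (by omega)

theorem homotopic_xPow_add_sgn (n : ℤ) (e : Bool) {L : ℕ} (hL : 30 * n.natAbs + 150 ≤ L) :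
    Homotopic QRels L (xPow n ++ xWord e) (xPow (n + sgn e)) := by
  have h1 := bitLen_le_natAbs n
  have h2 := length_aPow_le n
  have h3 := length_tPow n
  refine Homotopic.subst (aPow n) [(.t, e)]
    (Commutes.tPow_right (M := 10) (fun d => (commutes_t_a d e).symm) n le_rfl).symm ?_
    (by simp [xPow, xWord]) rfl ?_
  · simp only [List.length_singleton]; omega
  refine Homotopic.subst [] (tPow n ++ [(.t, e)]) (homotopic_aPow_add_sgn n e le_rfl) ?_
    (by simp) rfl ?_
  · simp only [List.length_append, List.length_nil, List.length_singleton]; omega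
  have h4 := length_aPow_le (n + sgn e)
  have h5 := bitLen_le_natAbs (n + sgn e)
  have h6 : (sgn e).natAbs = 1 := by cases e <;> rfl
  refine Homotopic.subst (aPow (n + sgn e)) [] (homotopic_tPow_add_sgn n e le_rfl) ?_
    (by simp) rfl ?_
  · simp only [List.length_nil]; omega
  simpa [xPow] using Homotopic.refl _ _

theorem xPow_r_xPow (d e : Bool) (n : ℕ) (j : ℤ) {L : ℕ} (hL : 40 * (n + j.natAbs) + 200 ≤ L) :
    Homotopic QRels L (xPow (sgn e * n) ++ [(.r, d)] ++ xPow j)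
      ([(.r, d)] ++ xPow (j + sgn e * n)) := by
  induction n generalizing j with
  | zero => simpa [xPow, aPow_zero, tPow_zero] using Homotopic.refl _ _
  | succ n ih =>
    have hs : (sgn e).natAbs = 1 := by cases e <;> rfl
    have hn : (sgn e * n).natAbs = n := by simp [Int.natAbs_mul, hs]
    have h1 := length_xPow_le (sgn e * n)
    have h2 := length_xPow_le j
    have h3 := bitLen_le_natAbs (sgn e * n)
    have h4 := bitLen_le_natAbs j
    rw [hn] at h1 h3
    have heq : sgn e * n + sgn e = sgn e * (n + 1 : ℕ) := by push_cast; ring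
    have hx := (homotopic_xPow_add_sgn (sgn e * n) e le_rfl).symm
    rw [heq, hn] at hx
    refine Homotopic.subst [] ([(.r, d)] ++ xPow j) hx ?_ (by simp) rfl ?_
    · simp only [List.length_append, List.length_nil, List.length_singleton]; omega
    refine Homotopic.subst (xPow (sgn e * n)) (xPow j) (xWord_commutes_r e d) (by omega)
      (by simp) rfl ?_
    refine Homotopic.subst (xPow (sgn e * n) ++ [(.r, d)]) []
      ((xWord_commutes_xPow e j le_rfl).trans (homotopic_xPow_add_sgn j e le_rfl))
      ?_ (by simp) rfl ?_
    · simp only [List.length_append, List.length_nil, List.length_singleton]; omega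
    have := ih (j + sgn e) (by omega)
    rw [show j + sgn e + sgn e * n = j + sgn e * (n + 1 : ℕ) by push_cast; ring] at this
    simpa using this

theorem commutes_xPow_r (d : Bool) (k : ℤ) {L : ℕ} (hL : 40 * k.natAbs + 200 ≤ L) :
    Commutes L (xPow k) [(.r, d)] := by
  have h : k = sgn (decide (0 ≤ k)) * k.natAbs := by
    rcases le_or_gt 0 k with h | h <;> simp [sgn, h, not_le.2, abs_of_nonneg, abs_of_neg]
  have := xPow_r_xPow d (decide (0 ≤ k)) k.natAbs 0 (L := L) (by simpa using hL)
  rw [← h] at this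
  simpa [Commutes, xPow, aPow_zero, tPow_zero] using this

theorem homotopic_r_pinch {m : List Syl} (hm : ∀ x ∈ m, x.IsAT) (h : sumT m = sumA m) (e : Bool)
    {L : ℕ} (hL : 200 * wt m + 500 ≤ L) :
    Homotopic QRels L ([(.r, e)] ++ real m ++ [(.r, !e)]) (real m) := by
  have h0 := homotopic_real_of_isAT hm le_rfl
  rw [h] at h0
  have h1 := natAbs_sumT_le m
  rw [h] at h1
  have h2 := length_xPow_le (sumA m)
  have h3 := bitLen_sumA_le m
  refine Homotopic.subst [(.r, e)] [(.r, !e)] h0 (by simp; omega) (by simp) rfl ?_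
  refine Homotopic.subst [] [(.r, !e)] (commutes_xPow_r e (sumA m) le_rfl).symm
    (by simp; omega) (by simp [xPow]) rfl ?_
  refine Homotopic.subst (xPow (sumA m)) [] (homotopic_cancel (x := .r) e le_rfl)
    (by simp; omega) (by simp) rfl ?_
  simpa [xPow] using h0.symm.mono (by omega)

/-! ### Conjugates of `s` by powers of `x` -/

/-- The conjugate of `s ^ ±1` by `a ^ i`. -/
def sConj (e : Bool) (i : ℤ) : Word QGen := aPow i ++ [(.s, e)] ++ aPow (-i)

theorem length_sConj_le (e : Bool) (i : ℤ) : (sConj e i).length ≤ 6 * bitLen i + 1 := by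
  have h1 := length_aPow_le i
  have h2 := length_aPow_le (-i)
  rw [bitLen_neg] at h2
  simp only [sConj, List.length_append, List.length_singleton]
  omega

theorem sConj_zero (e : Bool) : sConj e 0 = [(.s, e)] := by
  simp [sConj, aPow_zero]

theorem commutes_t_sConj (d e : Bool) (i : ℤ) {L : ℕ} (hL : 40 * bitLen i + 200 ≤ L) :
    Commutes L [(.t, d)] (sConj e i) := by
  have h1 := length_aPow_le i
  have h2 := length_aPow_le (-i)
  have h3 := bitLen_neg i
  refine Commutes.append_right (M := 30 * bitLen i + 150)
    (Commutes.append_right (M := 24 * bitLen i + 124) (commutes_t_aPow d i le_rfl)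
      ((commutes_s_t e d).symm.mono (by omega)) ?_)
    (commutes_t_aPow d (-i) (by omega)) ?_
  all_goals simp only [List.length_singleton, List.length_append]; omega

theorem bitLen_add_sgn_le (i : ℤ) (e : Bool) : bitLen (i + sgn e) ≤ bitLen i + 1 :=
  (bitLen_add_le _ _).trans (by cases e <;> simp [bitLen, sgn])

theorem homotopic_xWord_sConj (d e : Bool) (i : ℤ) {L : ℕ} (hL : 50 * bitLen i + 400 ≤ L) :
    Homotopic QRels L (xWord d ++ sConj e i) (sConj e (i + sgn d) ++ xWord d) := by
  have h1 := length_aPow_le i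
  have h2 := length_aPow_le (-i)
  have h3 := bitLen_neg i
  have h4 := bitLen_add_sgn_le i d
  have h5 := length_aPow_le (i + sgn d)
  have h6 := length_aPow_le (-(i + sgn d))
  have h7 := bitLen_neg (i + sgn d)
  have h8 := length_sConj_le e i
  refine Homotopic.subst [(.a, d)] [] (commutes_t_sConj d e i le_rfl)
    (by simp; omega) (by simp [xWord]) rfl ?_
  refine Homotopic.subst [] ([(.s, e)] ++ aPow (-i) ++ [(.t, d)])
    ((Commutes.aPow_right (commutes_self .a d true) i le_rfl).trans
      ((homotopic_aPow_add_sgn i d le_rfl).mono ?_)) ?_ (by simp [sConj]) rfl ?_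
  · simp only [List.length_singleton]; omega
  · simp only [List.length_append, List.length_singleton, List.length_nil]; omega
  have h9 := (homotopic_aPow_add_sgn (-(i + sgn d)) d le_rfl).symm
  rw [show -(i + sgn d) + sgn d = -i by ring] at h9
  refine Homotopic.subst (aPow (i + sgn d) ++ [(.s, e)]) [(.t, d)] h9 ?_ (by simp) rfl ?_
  · simp only [List.length_append, List.length_singleton]; omega
  simpa [sConj, xWord] using Homotopic.refl _ _

theorem homotopic_xWord_cancel (d : Bool) {L : ℕ} (hL : 12 ≤ L) :
    Homotopic QRels L (xWord (!d) ++ xWord d) [] := by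
  refine Homotopic.subst [(.a, !d)] [(.t, d)] (commutes_t_a (!d) d) (by simpa using hL)
    (by simp [xWord]) rfl ?_
  refine Homotopic.subst [] [(.t, !d), (.t, d)] (homotopic_cancel' (x := .a) d le_rfl)
    (by simp; omega) (by simp) rfl ?_
  exact homotopic_cancel' (x := .t) d (by omega)

theorem xWord_commutes_real {m : List Syl} (hm : ∀ x ∈ m, x.IsATR) (d : Bool) {L : ℕ}
    (hL : 30 * wt m + 200 ≤ L) : Commutes L (xWord d) (real m) := by
  have h1 := length_real_le m
  refine Commutes.flatMap (M := 24 * wt m + 130) (fun x hx => ?_) ?_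
  · have h2 : x.wt ≤ wt m := List.single_le_sum (by simp) _ (List.mem_map_of_mem hx)
    rcases x with n | e | e | e | e
    · exact xWord_commutes_aPow d n (by simp only [Syl.wt] at h2; omega)
    · exact (xWord_commutes_t d e).mono (by omega)
    · exact (xWord_commutes_r d e).mono (by omega)
    all_goals exact (hm _ hx).elim
  · change _ + (real m).length + 2 ≤ L
    omega

theorem xWord_commutes_inv_real {m : List Syl} (hm : ∀ x ∈ m, x.IsATR) (d : Bool) {L : ℕ}
    (hL : 40 * wt m + 210 ≤ L) : Commutes L (xWord d) (Word.inv (real m)) := by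
  have h1 := length_real_le m
  have h2 : (xWord d).length = 2 := rfl
  exact (Homotopic.comm_inv (xWord_commutes_real hm d le_rfl).symm (by omega)).symm

theorem homotopic_sConj_cancel (e : Bool) (i : ℤ) {L : ℕ} (hL : 60 * bitLen i + 200 ≤ L) :
    Homotopic QRels L (sConj e i ++ sConj (!e) i) [] := by
  have h1 := length_aPow_le i
  have h2 := length_aPow_le (-i)
  have h3 := bitLen_neg i
  have h4 := homotopic_aPow_add (-i) i le_rfl
  rw [neg_add_cancel, aPow_zero] at h4
  have h5 := homotopic_aPow_add i (-i) le_rfl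
  rw [add_neg_cancel, aPow_zero] at h5
  refine Homotopic.subst (aPow i ++ [(.s, e)]) ([(.s, !e)] ++ aPow (-i)) h4 ?_
    (by simp [sConj]) rfl ?_
  · simp only [List.length_append, List.length_singleton]; omega
  refine Homotopic.subst (aPow i) (aPow (-i)) (homotopic_cancel (x := .s) e le_rfl) ?_
    (by simp) rfl ?_
  · omega
  simpa using h5.mono (by omega)

theorem homotopic_inv_aPow_sConj_aPow (e : Bool) (n j : ℤ) {L : ℕ}
    (hL : 100 * (bitLen n + bitLen j) + 400 ≤ L) :
    Homotopic QRels L (Word.inv (aPow n) ++ sConj e j ++ aPow n) (sConj e (j - n)) := by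
  have h1 := length_aPow_le j
  have h2 := length_aPow_le (-j)
  have h3 := bitLen_neg j
  have h4 := length_aPow_le n
  have h5 := length_aPow_le (-n)
  have h6 := bitLen_neg n
  have h7 := homotopic_aPow_add (-n) j le_rfl
  rw [neg_add_eq_sub] at h7
  have h8 := homotopic_aPow_add (-j) n le_rfl
  rw [show -j + n = -(j - n) by ring] at h8
  have h9 := length_sConj_le e j
  refine Homotopic.subst [] (sConj e j ++ aPow n) (homotopic_inv_aPow n le_rfl) ?_
    (by simp) rfl ?_
  · simp only [List.length_append, List.length_nil]; omega
  refine Homotopic.subst (aPow (-n) ++ aPow j ++ [(.s, e)]) [] h8 ?_ (by simp [sConj]) rfl ?_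
  · simp only [List.length_append, List.length_nil, List.length_singleton]; omega
  have h10 := length_aPow_le (-(j - n))
  have h11 := bitLen_add_le (-j) n
  rw [show -j + n = -(j - n) by ring] at h11
  refine Homotopic.subst [] ([(.s, e)] ++ aPow (-(j - n))) h7 ?_ (by simp) rfl ?_
  · simp only [List.length_append, List.length_nil, List.length_singleton]; omega
  simpa [sConj] using Homotopic.refl _ _

theorem homotopic_inv_letter_conj {x : QGen} {d : Bool} {v : Word QGen} {M L : ℕ}
    (h : Commutes M [(x, !d)] v) (hL : M + v.length + 2 ≤ L) :
    Homotopic QRels L (Word.inv [(x, d)] ++ v ++ [(x, d)]) v := by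
  refine Homotopic.subst [] [(x, d)] h (by simp; omega) (by simp [Word.inv]) rfl ?_
  refine Homotopic.subst v [] (homotopic_cancel' (x := x) d le_rfl) (by simp; omega)
    (by simp) rfl ?_
  simpa using Homotopic.refl _ _

/-- The word `m * x ^ i s ^ ±1 x ^ (-i) * m⁻¹ * x ^ j s ^ ∓1 x ^ (-j)`. -/
def sWord (m : List Syl) (e : Bool) (i j : ℤ) : Word QGen :=
  real m ++ sConj e i ++ Word.inv (real m) ++ sConj (!e) j

theorem fills_sWord_shift {m : List Syl} (hm : ∀ x ∈ m, x.IsATR) {e d : Bool} {i j : ℤ} {L : ℕ}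
    (hL : 100 * (wt m + bitLen i + bitLen j) + 2000 ≤ L)
    (h : Fills QRels L (sWord m e (i + sgn d) (j + sgn d))) : Fills QRels L (sWord m e i j) := by
  have h1 := length_real_le m
  have h2 := Word.length_inv (real m)
  have h3 := length_sConj_le e i
  have h4 := length_sConj_le (!e) j
  have h5 := length_sConj_le e (i + sgn d)
  have h6 := length_sConj_le (!e) (j + sgn d)
  have h7 := bitLen_add_sgn_le i d
  have h8 := bitLen_add_sgn_le j d
  have h9 : (xWord (!d)).length = 2 := rfl
  have h10 : (xWord d).length = 2 := rfl
  refine Fills.subst [] (sWord m e i j) (homotopic_xWord_cancel d le_rfl).symm ?_ rfl rfl ?_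
  · simp only [sWord, List.length_append, List.length_nil]; omega
  refine Fills.rotate (xWord (!d)) (xWord d ++ sWord m e i j) (by simp) rfl ?_
  refine Fills.subst [] (sConj e i ++ Word.inv (real m) ++ sConj (!e) j ++ xWord (!d))
    (xWord_commutes_real hm d le_rfl) ?_ (by simp [sWord]) rfl ?_
  · simp only [List.length_append, List.length_nil]; omega
  refine Fills.subst (real m) (Word.inv (real m) ++ sConj (!e) j ++ xWord (!d))
    (homotopic_xWord_sConj d e i le_rfl) ?_ (by simp) rfl ?_
  · simp only [List.length_append]; omega
  refine Fills.subst (real m ++ sConj e (i + sgn d)) (sConj (!e) j ++ xWord (!d))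
    (xWord_commutes_inv_real hm d le_rfl) ?_ (by simp) rfl ?_
  · simp only [List.length_append]; omega
  refine Fills.subst (real m ++ sConj e (i + sgn d) ++ Word.inv (real m)) (xWord (!d))
    (homotopic_xWord_sConj d (!e) j le_rfl) ?_ (by simp) rfl ?_
  · simp only [List.length_append]; omega
  refine Fills.subst (sWord m e (i + sgn d) (j + sgn d)) []
    (v := []) (homotopic_xWord_cancel (!d) le_rfl) ?_ (by simp [sWord]) rfl (by simpa using h)
  simp only [sWord, List.length_append, List.length_nil]; omega

theorem fills_sWord_shift_mul {m : List Syl} (hm : ∀ x ∈ m, x.IsATR) {e d : Bool} (n : ℕ) {N : ℕ}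
    {i j : ℤ} {L : ℕ} (hi : i.natAbs + n ≤ N) (hj : j.natAbs + n ≤ N)
    (hL : 100 * wt m + 200 * N.size + 2000 ≤ L)
    (h : Fills QRels L (sWord m e (i + sgn d * n) (j + sgn d * n))) :
    Fills QRels L (sWord m e i j) := by
  induction n generalizing i j with
  | zero => simpa using h
  | succ n ih =>
    have h1 : (sgn d).natAbs = 1 := by cases d <;> rfl
    have h2 : bitLen i ≤ N.size := bitLen_le_size (by omega)
    have h3 : bitLen j ≤ N.size := bitLen_le_size (by omega)
    refine fills_sWord_shift hm (d := d) (by omega) (ih (by omega) (by omega) ?_)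
    push_cast at h
    convert h using 2 <;> ring

theorem fills_sWord {m : List Syl} (hm : ∀ x ∈ m, x.IsATR) (e : Bool) {i : ℤ} {N L : ℕ}
    (hi : i.natAbs ≤ N) (hN : absA m ≤ N) (hL : 200 * wt m + 2000 * N.size + 5000 ≤ L) :
    Fills QRels L (sWord m e i (i + sumA m)) := by
  induction m generalizing i with
  | nil =>
    have h1 : bitLen i ≤ N.size := bitLen_le_size hi
    refine .of_homotopic ?_ (.nil _)
    simpa [sWord, Word.inv_nil] using homotopic_sConj_cancel e i (by omega)
  | cons x m ih =>
    have hx := hm x (by simp)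
    have hm' : ∀ x ∈ m, x.IsATR := fun y hy => hm y (by simp [hy])
    have h1 := length_real_le m
    have h2 := Word.length_inv (real m)
    have h3 := length_sConj_le e i
    have h4 : bitLen i ≤ N.size := bitLen_le_size hi
    have h5 := natAbs_sumA_le m
    have hsz (k : ℤ) (hk : k.natAbs ≤ 3 * N) : bitLen k ≤ 3 * N.size := by
      refine (bitLen_le_size hk).trans ?_
      have := Nat.size_add_le (N + N) N
      have := Nat.size_add_le N N
      rw [show 3 * N = N + N + N by ring]
      omega
    simp only [absA_cons, wt_cons] at hN hL
    rcases x with n | d | d | d | d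
    · simp only [Syl.wt, Syl.expA, sumA_cons] at hN hL ⊢
      obtain ⟨j, hj⟩ : ∃ j, j = i + (n + sumA m) := ⟨_, rfl⟩
      rw [← hj]
      have h6 := hsz j (by omega)
      refine .rotate (aPow n) (real m ++ sConj e i ++ Word.inv (real m) ++
        Word.inv (aPow n) ++ sConj (!e) j) (by simp [sWord, Syl.word, Word.inv_append]) rfl ?_
      refine .subst (real m ++ sConj e i ++ Word.inv (real m)) []
        (homotopic_inv_aPow_sConj_aPow (!e) n j le_rfl) ?_ (by simp) rfl ?_
      · simp only [List.length_append, List.length_nil]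
        linarith
      · have := ih hm' hi (by omega) (by omega)
        rw [show i + sumA m = j - n by omega] at this
        simpa [sWord] using this
    · simp only [Syl.wt, Syl.expA, sumA_cons, zero_add] at hN hL ⊢
      obtain ⟨j, hj⟩ : ∃ j, j = i + sumA m := ⟨_, rfl⟩
      rw [← hj]
      have h6 := hsz j (by omega)
      have h7 := length_sConj_le (!e) j
      refine .rotate [(.t, d)] (real m ++ sConj e i ++ Word.inv (real m) ++
        Word.inv [(.t, d)] ++ sConj (!e) j)
        (by simp [sWord, Syl.word, Word.inv_cons, Word.inv_nil]) rfl ?_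
      refine .subst (real m ++ sConj e i ++ Word.inv (real m)) []
        (homotopic_inv_letter_conj (commutes_t_sConj (!d) (!e) j le_rfl) le_rfl) ?_ (by simp) rfl ?_
      · simp only [List.length_append, List.length_nil]; omega
      · simpa [sWord, hj] using ih hm' hi (by omega) (by omega)
    · simp only [Syl.wt, Syl.expA, sumA_cons, zero_add] at hN hL ⊢
      obtain ⟨j, hj⟩ : ∃ j, j = i + sumA m := ⟨_, rfl⟩
      rw [← hj]
      have h6 := Nat.size_add_le (N + N) (N + N)
      have h7 := Nat.size_add_le N N
      obtain ⟨d', hd'⟩ : ∃ d', -j = sgn d' * j.natAbs := by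
        refine ⟨decide (j ≤ 0), ?_⟩
        rcases le_or_gt j 0 with h | h <;>
          simp [sgn, h, not_le.2, abs_of_nonpos, abs_of_pos]
      refine fills_sWord_shift_mul hm (d := d') j.natAbs (N := N + N + (N + N)) (by omega)
        (by omega) (by simp only [wt_cons, Syl.wt]; omega) ?_
      rw [← hd', show i + -j = -sumA m by omega, add_neg_cancel, sWord, sConj_zero]
      have h8 := length_sConj_le e (-sumA m)
      have h9 := hsz (-sumA m) (by omega)
      refine .rotate [(.r, d)] (real m ++ sConj e (-sumA m) ++ Word.inv (real m) ++
        Word.inv [(.r, d)] ++ [(.s, !e)]) (by simp [Syl.word, Word.inv_cons, Word.inv_nil]) rfl ?_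
      refine .subst (real m ++ sConj e (-sumA m) ++ Word.inv (real m)) []
        (homotopic_inv_letter_conj (commutes_r_s (!d) (!e)) le_rfl) ?_ (by simp) rfl ?_
      · simp only [List.length_append, List.length_nil, List.length_singleton]; omega
      · have := ih hm' (i := -sumA m) (by omega) (by omega) (by omega)
        rw [neg_add_cancel, sWord, sConj_zero] at this
        simpa using this
    all_goals exact hx.elim

theorem fills_s_pinch {m : List Syl} (hm : ∀ x ∈ m, x.IsATR) (h : sumA m = 0) (e : Bool) {L : ℕ}
    (hL : 2200 * wt m + 5000 ≤ L) :
    Fills QRels L ([(.s, e)] ++ real m ++ [(.s, !e)] ++ Word.inv (real m)) := by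
  have h1 := size_absA_le m
  have := fills_sWord hm (!e) (i := 0) (N := absA m) (L := L) (by simp) le_rfl (by omega)
  rw [h, add_zero, sWord, sConj_zero, sConj_zero, Bool.not_not] at this
  exact .rotate [(.s, e)] (real m ++ [(.s, !e)] ++ Word.inv (real m)) (by simp) (by simp) this

/-! ### Words without `b` -/

section

variable {G σ : Type*} [Group G] {A B : Subgroup G} (φ : A ≃* B) (c : σ → G ⊕ ℤˣ)

@[simp] theorem hnnVal_append (l l' : List σ) :
    hnnVal φ c (l ++ l') = hnnVal φ c l * hnnVal φ c l' := by simp [hnnVal]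

@[simp] theorem hnnVal_cons (x : σ) (l : List σ) : hnnVal φ c (x :: l) =
    Sum.elim HNNExtension.of (fun u : ℤˣ => HNNExtension.t ^ (u : ℤ)) (c x) * hnnVal φ c l := by
  simp [hnnVal]

@[simp] theorem hnnVal_nil : hnnVal φ c [] = 1 := rfl

theorem hnnVal_of_isLeft {l : List σ} (hl : ∀ x ∈ l, (c x).isLeft) :
    hnnVal φ c l = HNNExtension.of (baseVal c l) := by
  induction l with
  | nil => simp [baseVal]
  | cons x l ih =>
    simp only [List.mem_cons, forall_eq_or_imp] at hl
    rw [hnnVal_cons, ih hl.2]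
    rcases hx : c x with g | u
    · simp [baseVal, hx]
    · simp [hx] at hl

end

/-- The sign of an exponent as a unit of `ℤ`. -/
def sgnUnit (e : Bool) : ℤˣ := if e then 1 else -1

theorem eq_not_of_sgnUnit_eq_neg {d e : Bool} (h : sgnUnit d = -sgnUnit e) : d = !e := by
  revert h
  cases d <;> cases e <;> decide

/-- The free group of rank two, as an HNN extension of `ℤ`. -/
abbrev FreeHNN := HNNExtension (Multiplicative ℤ) ⊥ ⊥ (MulEquiv.refl _)

open Multiplicative in
/-- The symbols of the factor generated by `x = at` and `s`. -/
def symX : Syl → Multiplicative ℤ ⊕ ℤˣ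
  | .A n => .inl (ofAdd n)
  | .S e => .inr (sgnUnit e)
  | _ => .inl 1

open Multiplicative in
/-- The symbols of the factor generated by `t` and `r`. -/
def symT : Syl → Multiplicative ℤ ⊕ ℤˣ
  | .A n => .inl (ofAdd (-n))
  | .T e => .inl (ofAdd (sgn e))
  | .R e => .inr (sgnUnit e)
  | _ => .inl 1

/-- The component of an element in the factor generated by `x = at` and `s`. -/
def valX (l : List Syl) : FreeHNN := hnnVal (MulEquiv.refl _) symX l

/-- The component of an element in the factor generated by `t` and `r`. -/
def valT (l : List Syl) : FreeHNN := hnnVal (MulEquiv.refl _) symT l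

theorem baseVal_symX (l : List Syl) : baseVal symX l = Multiplicative.ofAdd (sumA l) := by
  induction l with
  | nil => rfl
  | cons x l ih =>
    simp only [baseVal, List.map_cons, List.prod_cons, sumA_cons, ofAdd_add] at ih ⊢
    rw [ih]
    cases x <;> rfl

theorem baseVal_symT (l : List Syl) : baseVal symT l = Multiplicative.ofAdd (sumT l - sumA l) := by
  induction l with
  | nil => rfl
  | cons x l ih =>
    simp only [baseVal, List.map_cons, List.prod_cons, sumA_cons, sumT_cons] at ih ⊢
    rw [ih, add_sub_add_comm, ofAdd_add]
    congr 1
    cases x <;> simp [symT, Syl.expA, Syl.expT]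

theorem mem_toSubgroup_bot {g : Multiplicative ℤ} {u : ℤˣ} :
    g ∈ HNNExtension.toSubgroup (⊥ : Subgroup (Multiplicative ℤ)) ⊥ u ↔ g = 1 := by
  simp [HNNExtension.toSubgroup, Subgroup.mem_bot]

/-- A syllable other than `b ^ ±1`. -/
def Syl.NotB : Syl → Prop
  | B _ => False
  | _ => True

theorem Syl.NotB.isATR {x : Syl} (h : x.NotB) (hx : (symX x).isLeft) : x.IsATR := by
  cases x <;> simp_all [NotB, symX, IsATR]

theorem Syl.IsATR.isAT {x : Syl} (h : x.IsATR) (hx : (symT x).isLeft) : x.IsAT := by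
  cases x <;> simp_all [IsAT, symT, IsATR]

theorem exists_eq_S {x : Syl} {u : ℤˣ} (h : symX x = .inr u) : ∃ e, x = .S e ∧ u = sgnUnit e := by
  cases x <;> simp_all [symX]

theorem exists_eq_R {x : Syl} {u : ℤˣ} (h : symT x = .inr u) : ∃ e, x = .R e ∧ u = sgnUnit e := by
  cases x <;> simp_all [symT]

theorem fills_of_val_eq_one {l : List Syl} (hl : ∀ x ∈ l, x.NotB) (hX : valX l = 1)
    (hT : valT l = 1) {L : ℕ} (hL : 3000 * wt l + 10000 ≤ L) : Fills QRels L (real l) := by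
  induction hn : l.length using Nat.strong_induction_on generalizing l with
  | _ n ih =>
  rcases hasPinch_of_hnnVal_eq_one _ _ hX with ⟨p, x, m, y, q, u, rfl, hx, hy, hm, hu⟩ | ⟨hm, hs⟩
  · obtain ⟨e, rfl, rfl⟩ := exists_eq_S hx
    obtain ⟨d, rfl, hd⟩ := exists_eq_S hy
    obtain rfl := eq_not_of_sgnUnit_eq_neg hd.symm
    rw [mem_toSubgroup_bot, baseVal_symX, ofAdd_eq_one] at hu
    have hm' : ∀ x ∈ m, x.IsATR := fun x hx => (hl x (by simp [hx])).isATR (hm x hx)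
    have h1 := length_real_le m
    have h2 := length_real_le p
    have h3 := length_real_le q
    simp only [wt_append, wt_cons, Syl.wt] at hL
    have h4 := fills_s_pinch hm' hu e le_rfl
    have := Fills.replace (L := L) (p := real p) (q := real q) h4 (by linarith) ?_
    · simpa [Syl.word] using this
    · have := ih (p ++ m ++ q).length (by simp [← hn]) (l := p ++ m ++ q) ?_ ?_ ?_ ?_ rfl
      · simpa using this
      · intro x hx
        apply hl
        simp only [List.mem_append, List.mem_cons] at hx ⊢
        tauto
      · rw [← hX]
        have : HNNExtension.t ^ (sgnUnit e : ℤ) * HNNExtension.t ^ ((-sgnUnit e : ℤˣ) : ℤ) =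
          (1 : FreeHNN) := by simp
        simp [valX, hnnVal_of_isLeft _ _ hm, baseVal_symX, hu, hx, hy, ← mul_assoc]
      · rw [← hT]
        simp [valT, symT]
      · simp only [wt_append]
        omega
  rw [baseVal_symX, ofAdd_eq_one] at hs
  have hm' : ∀ x ∈ l, x.IsATR := fun x hx => (hl x hx).isATR (hm x hx)
  rcases hasPinch_of_hnnVal_eq_one _ _ hT with ⟨p, x, m, y, q, u, rfl, hx, hy, hr, hu⟩ | ⟨hr, hs'⟩
  · obtain ⟨e, rfl, rfl⟩ := exists_eq_R hx
    obtain ⟨d, rfl, hd⟩ := exists_eq_R hy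
    obtain rfl := eq_not_of_sgnUnit_eq_neg hd.symm
    rw [mem_toSubgroup_bot, baseVal_symT, ofAdd_eq_one] at hu
    have hr' : ∀ x ∈ m, x.IsAT := fun x hx => (hm' x (by simp [hx])).isAT (hr x hx)
    have h1 := length_real_le m
    have h2 := length_real_le p
    have h3 := length_real_le q
    simp only [wt_append, wt_cons, Syl.wt] at hL
    refine Fills.subst (real p) (real q) (homotopic_r_pinch hr' (sub_eq_zero.1 hu) e le_rfl)
      (by omega) (by simp [Syl.word]) rfl ?_
    · have := ih (p ++ m ++ q).length (by simp [← hn]) (l := p ++ m ++ q) ?_ ?_ ?_ ?_ rfl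
      · simpa using this
      · intro x hx
        apply hl
        simp only [List.mem_append, List.mem_cons] at hx ⊢
        tauto
      · rw [← hX]
        simp [valX, symX]
      · rw [← hT]
        simp [valT, hnnVal_of_isLeft _ _ hr, baseVal_symT, hu, hx, hy, ← mul_assoc]
      · simp only [wt_append]
        omega
  · rw [baseVal_symT, hs, ofAdd_eq_one, sub_zero] at hs'
    refine .of_homotopic (homotopic_real_of_isAT (fun x hx => (hm' x hx).isAT (hr x hx)) ?_) ?_
    · omega
    · rw [hs, hs', aPow_zero, tPow_zero]
      exact .nil _

/-! ### The group as an HNN extension with stable letter `b⁻¹` -/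

/-- The direct product of two free groups of rank two. -/
abbrev FreeHNNProd := FreeHNN × FreeHNN

/-- The powers of `a` in the subgroup generated by `a`, `r`, `s`, `t`. -/
def powA : Multiplicative ℤ →* FreeHNNProd :=
  HNNExtension.of.prod (HNNExtension.of.comp invMonoidHom)

/-- The powers of `a²` in the subgroup generated by `a`, `r`, `s`, `t`. -/
def powASq : Multiplicative ℤ →* FreeHNNProd := powA.comp (powMonoidHom 2)

theorem powA_injective : Function.Injective powA := fun _ _ h =>
  HNNExtension.of_injective (MulEquiv.refl _) (congrArg Prod.fst h)

theorem powASq_injective : Function.Injective powASq := by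
  refine powA_injective.comp fun m n h => ?_
  apply Multiplicative.toAdd.injective
  have := congrArg Multiplicative.toAdd h
  simpa using this

/-- Conjugation by `b⁻¹` maps `a ^ n` to `a ^ (2 * n)`. -/
noncomputable def conjB : powA.range ≃* powASq.range :=
  (MonoidHom.ofInjective powA_injective).symm.trans (MonoidHom.ofInjective powASq_injective)

theorem conj_powA (n : Multiplicative ℤ) :
    (HNNExtension.t * HNNExtension.of (powA n) * HNNExtension.t⁻¹ :
      HNNExtension FreeHNNProd _ _ conjB) = HNNExtension.of (powASq n) := by
  have := HNNExtension.equiv_eq_conj (φ := conjB) ⟨powA n, n, rfl⟩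
  rw [← this]
  congr 1
  have h : (⟨powA n, n, rfl⟩ : powA.range) = MonoidHom.ofInjective powA_injective n := rfl
  rw [h, conjB, MulEquiv.trans_apply, MulEquiv.symm_apply_apply]
  rfl

/-- The symbols of the HNN extension with stable letter `b⁻¹`. -/
def symB : Syl → FreeHNNProd ⊕ ℤˣ
  | .B e => .inr (sgnUnit (!e))
  | x => .inl (valX [x], valT [x])

theorem symB_of_notB {x : Syl} (h : x.NotB) : symB x = .inl (valX [x], valT [x]) := by
  cases x <;> first | rfl | exact h.elim

theorem Syl.notB_of_isLeft {x : Syl} (h : (symB x).isLeft) : x.NotB := by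
  cases x <;> simp_all [NotB, symB]

theorem exists_eq_B {x : Syl} {u : ℤˣ} (h : symB x = .inr u) :
    ∃ e, x = .B e ∧ u = sgnUnit (!e) := by
  cases x <;> simp_all [symB]

theorem baseVal_symB {m : List Syl} (hm : ∀ x ∈ m, x.NotB) :
    baseVal symB m = (valX m, valT m) := by
  induction m with
  | nil => rfl
  | cons x m ih =>
    simp only [List.mem_cons, forall_eq_or_imp] at hm
    have := ih hm.2
    simp only [baseVal, List.map_cons, List.prod_cons] at this ⊢
    rw [this, symB_of_notB hm.1]
    simp [valX, valT]

theorem sumA_eq_of_valX {m : List Syl} {n : ℤ}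
    (h : valX m = HNNExtension.of (Multiplicative.ofAdd n)) : sumA m = n := by
  let f : FreeHNN →* Multiplicative ℤ :=
    HNNExtension.lift (MonoidHom.id _) 1 (by rintro ⟨a, ha⟩; simp)
  have key (l : List Syl) : f (valX l) = Multiplicative.ofAdd (sumA l) := by
    induction l with
    | nil => exact map_one f
    | cons x l ih =>
      rw [valX, hnnVal_cons, map_mul, ← valX, ih, sumA_cons, ofAdd_add]
      congr 1
      cases x <;> simp [symX, f, Syl.expA]
  have := key m
  rw [h] at this
  simpa [f] using this.symm

theorem fills_mul_inv_aPow {m : List Syl} (hm : ∀ x ∈ m, x.NotB) {n : ℤ}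
    (h : (valX m, valT m) = powA (Multiplicative.ofAdd n)) {L : ℕ}
    (hL : 7000 * wt m + 20000 ≤ L) : Fills QRels L (real m ++ Word.inv (aPow n)) := by
  have hX : valX m = HNNExtension.of (Multiplicative.ofAdd n) := congrArg Prod.fst h
  have hT : valT m = HNNExtension.of (Multiplicative.ofAdd (-n)) := congrArg Prod.snd h
  have h1 := length_real_le m
  have h2 := bitLen_sumA_le m
  rw [sumA_eq_of_valX hX] at h2
  have h3 := bitLen_neg n
  refine Fills.subst (real m) [] (homotopic_inv_aPow n le_rfl)
    (by simp only [List.length_nil]; omega) (by simp) rfl ?_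
  have := fills_of_val_eq_one (l := m ++ [.A (-n)]) (L := L) ?_ ?_ ?_ ?_
  · simpa [Syl.word] using this
  · simp only [List.mem_append, List.mem_singleton]
    rintro x (hx | rfl)
    · exact hm x hx
    · trivial
  · rw [valX, hnnVal_append, ← valX, hX]
    simp [symX]
  · rw [valT, hnnVal_append, ← valT, hT]
    simp [symT]
  · simp only [wt_append, wt_cons, wt_nil, Syl.wt]
    omega

theorem hnnVal_of_powA {m : List Syl} (hm : ∀ x ∈ m, (symB x).isLeft) {n : Multiplicative ℤ}
    (h : (valX m, valT m) = powA n) : hnnVal conjB symB m = HNNExtension.of (powA n) := by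
  rw [hnnVal_of_isLeft _ _ hm, baseVal_symB fun x hx => Syl.notB_of_isLeft (hm x hx), h]

theorem symB_A (n : ℤ) : symB (.A n) = .inl (powA (Multiplicative.ofAdd n)) := by
  simp [symB, valX, valT, symX, symT, powA]

theorem powASq_eq (n : Multiplicative ℤ) :
    powASq n = powA (Multiplicative.ofAdd (2 * n.toAdd)) := by
  change powA (n ^ 2) = _
  rw [two_mul, ofAdd_add, ofAdd_toAdd, pow_two]

theorem hnnVal_A (n : ℤ) :
    hnnVal conjB symB [.A n] = HNNExtension.of (powA (Multiplicative.ofAdd n)) := by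
  rw [hnnVal_cons, symB_A]
  simp only [Sum.elim_inl, hnnVal_nil, mul_one]

theorem hnnVal_B_true : hnnVal conjB symB [.B true] = HNNExtension.t⁻¹ := by
  simp [hnnVal_cons, symB, sgnUnit]

theorem hnnVal_B_false : hnnVal conjB symB [.B false] = HNNExtension.t := by
  simp [hnnVal_cons, symB, sgnUnit]

theorem fills_of_hnnVal_eq_one {l : List Syl} (h : hnnVal conjB symB l = 1) {L : ℕ}
    (hL : 10000 * wt l + 30000 ≤ L) : Fills QRels L (real l) := by
  induction hn : l.length using Nat.strong_induction_on generalizing l with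
  | _ n ih =>
  rcases hasPinch_of_hnnVal_eq_one _ _ h with ⟨p, x, m, y, q, u, rfl, hx, hy, hm, hu⟩ | ⟨hm, hs⟩
  · obtain ⟨e, rfl, rfl⟩ := exists_eq_B hx
    obtain ⟨d, rfl, hd⟩ := exists_eq_B hy
    obtain rfl : d = !e := by simpa using eq_not_of_sgnUnit_eq_neg hd.symm
    have hm' : ∀ x ∈ m, x.NotB := fun x hx => Syl.notB_of_isLeft (hm x hx)
    rw [baseVal_symB hm'] at hu
    have h1 := length_real_le m
    have h2 := length_real_le p
    have h3 := length_real_le q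
    simp only [wt_append, wt_cons, Syl.wt] at hL
    have reduce (N K : ℤ) (hN : (valX m, valT m) = powA (Multiplicative.ofAdd N))
        (hK : bitLen K ≤ bitLen N + 1)
        (hw : Homotopic QRels (3 * bitLen N + 10) ([(.b, e)] ++ aPow N ++ [(.b, !e)]) (aPow K))
        (hv : hnnVal conjB symB [.A K] = hnnVal conjB symB ([.B e] ++ m ++ [.B !e])) :
        Fills QRels L (real (p ++ .B e :: (m ++ .B (!e) :: q))) := by
      have h4 := bitLen_sumA_le m
      rw [sumA_eq_of_valX (congrArg Prod.fst hN)] at h4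
      have h5 := length_aPow_le N
      have h6 := Fills.replace (L := L) (p := real p ++ [(.b, e)]) (q := [(.b, !e)] ++ real q)
        (fills_mul_inv_aPow hm' hN le_rfl) ?_ ?_
      · simpa [Syl.word] using h6
      · simp only [List.length_append, List.length_singleton]
        linarith
      · refine Fills.subst (real p) (real q) hw (by linarith) (by simp) rfl ?_
        have := ih (p ++ .A K :: q).length ?_ (l := p ++ .A K :: q) ?_ ?_ rfl
        · simpa [Syl.word] using this
        · simp [← hn]
        · rw [← h]
          simp only [hnnVal_append, hnnVal_cons, hnnVal_nil, mul_one] at hv ⊢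
          rw [hv]
          simp [mul_assoc]
        · simp only [wt_append, wt_cons, Syl.wt]
          linarith
    cases e with
    | false =>
      obtain ⟨N, hN⟩ := hu
      refine reduce N.toAdd (2 * N.toAdd) hN.symm (bitLen_two_mul_le _)
        (homotopic_b_conj_aPow _ (by omega)) ?_
      simp only [hnnVal_append, hnnVal_of_powA hm hN.symm]
      rw [hnnVal_A, ← powASq_eq, ← conj_powA, hnnVal_B_false, Bool.not_false, hnnVal_B_true]
    | true =>
      obtain ⟨N, hN⟩ := hu
      have hN' : (valX m, valT m) = powA (Multiplicative.ofAdd (2 * N.toAdd)) := by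
        rw [← hN, ← powASq_eq]
      refine reduce (2 * N.toAdd) N.toAdd hN' ?_ ((homotopic_b_conj_aPow' _ le_rfl).mono ?_) ?_
      · exact (bitLen_le (by rw [Int.natAbs_mul]; simp; omega)).trans (Nat.le_succ _)
      · have : bitLen N.toAdd ≤ bitLen (2 * N.toAdd) :=
          bitLen_le (by rw [Int.natAbs_mul]; simp; omega)
        omega
      simp only [hnnVal_append, hnnVal_of_powA hm hN']
      rw [hnnVal_A, ← powASq_eq, ← conj_powA, hnnVal_B_true, Bool.not_true, hnnVal_B_false,
        ofAdd_toAdd]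
      simp only [mul_assoc, inv_mul_cancel_left, inv_mul_cancel, mul_one]
  · rw [baseVal_symB fun x hx => Syl.notB_of_isLeft (hm x hx), Prod.mk_eq_one] at hs
    exact fills_of_val_eq_one (fun x hx => Syl.notB_of_isLeft (hm x hx)) hs.1 hs.2 (by omega)

/-! ### The group of the presentation `Q` -/

/-- The images of the generators of `Q` in the HNN extension with stable letter `b⁻¹`. -/
noncomputable def genVal : QGen → HNNExtension FreeHNNProd _ _ conjB
  | .a => HNNExtension.of (powA (Multiplicative.ofAdd 1))
  | .b => HNNExtension.t⁻¹
  | .r => HNNExtension.of (1, HNNExtension.t)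
  | .s => HNNExtension.of (HNNExtension.t, 1)
  | .t => HNNExtension.of (1, HNNExtension.of (Multiplicative.ofAdd 1))

theorem lift_genVal_eq_one {w : Word QGen} (hw : NullHomotopic QRels w) :
    FreeGroup.lift genVal (FreeGroup.mk w) = 1 := by
  suffices Subgroup.normalClosure (FreeGroup.mk '' QRels) ≤ (FreeGroup.lift genVal).ker from
    this hw
  refine Subgroup.normalClosure_le_normal ?_
  have hb : (HNNExtension.t * HNNExtension.of (powA (Multiplicative.ofAdd 1)) * HNNExtension.t⁻¹ :
      HNNExtension FreeHNNProd _ _ conjB) = HNNExtension.of (powA (Multiplicative.ofAdd 1)) *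
        HNNExtension.of (powA (Multiplicative.ofAdd 1)) := by
    rw [conj_powA, powASq_eq, ← map_mul, ← map_mul]
    rfl
  rintro _ ⟨w, hw, rfl⟩
  rw [SetLike.mem_coe, MonoidHom.mem_ker]
  rcases hw with rfl | rfl | rfl | rfl | rfl
  · simp only [FreeGroup.lift_mk, List.map_cons, List.map_nil, List.prod_cons, List.prod_nil,
      genVal, cond_true, cond_false, inv_inv, mul_one]
    rw [← mul_assoc, ← mul_assoc, ← mul_assoc, hb]
    group
  all_goals
    simp only [FreeGroup.lift_mk, List.map_cons, List.map_nil, List.prod_cons, List.prod_nil,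
      genVal, cond_true, cond_false, ← map_mul, ← map_inv, mul_one]
    refine (congrArg HNNExtension.of ?_).trans (map_one _)
    refine Prod.ext ?_ ?_ <;> simp [powA]

/-- The syllable of a letter. -/
def letterSyl : QGen × Bool → Syl
  | (.a, e) => .A (sgn e)
  | (.b, e) => .B e
  | (.r, e) => .R e
  | (.s, e) => .S e
  | (.t, e) => .T e

theorem hnnVal_map_letterSyl (w : Word QGen) :
    hnnVal conjB symB (w.map letterSyl) = FreeGroup.lift genVal (FreeGroup.mk w) := by
  have key (x : QGen × Bool) :
      hnnVal conjB symB [letterSyl x] = cond x.2 (genVal x.1) (genVal x.1)⁻¹ := by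
    rcases x with ⟨_ | _, _ | _⟩ <;>
      simp only [letterSyl, genVal, hnnVal_A, hnnVal_B_true, hnnVal_B_false, cond_true, cond_false,
        ← map_inv, inv_inv] <;>
      first | rfl | rw [hnnVal_cons, hnnVal_nil, mul_one, symB]
      <;> simp [valX, valT, symX, symT, sgn, sgnUnit]
  rw [FreeGroup.lift_mk]
  induction w with
  | nil => rfl
  | cons x w ih =>
    rw [List.map_cons, List.map_cons, List.prod_cons, ← ih, ← key, ← hnnVal_append]
    rfl

theorem wt_map_letterSyl (w : Word QGen) : wt (w.map letterSyl) = w.length := by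
  induction w with
  | nil => rfl
  | cons x w ih =>
    rw [List.map_cons, wt_cons, ih, List.length_cons, add_comm]
    rcases x with ⟨_ | _, _ | _⟩ <;> rfl

theorem homotopic_real_map_letterSyl (w : Word QGen) {L : ℕ} (hL : 3 * w.length + 40 ≤ L) :
    Homotopic QRels L w (real (w.map letterSyl)) := by
  have key (x : QGen × Bool) : Homotopic QRels 31 [x] (letterSyl x).word := by
    rcases x with ⟨_ | _, e⟩
    · simpa [aPow_zero, letterSyl, Syl.word] using
        homotopic_aPow_add_sgn 0 e (L := 31) (by simp [bitLen])
    all_goals exact Homotopic.refl _ _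
  induction w generalizing L with
  | nil => exact Homotopic.refl _ _
  | cons x w ih =>
    rw [List.length_cons] at hL
    have h := length_real_le (w.map letterSyl)
    rw [wt_map_letterSyl] at h
    refine Homotopic.subst [x] [] (ih le_rfl) ?_ (by simp) rfl ?_
    · simp only [List.length_singleton, List.length_nil]; omega
    exact Homotopic.subst [] (real (w.map letterSyl)) (key x)
      (by simp only [List.length_nil]; omega) (by simp) (by simp [real]) (.refl _ _)

theorem FFFL_linear_upper_bound :
    ∃ C : ℕ, 0 < C ∧ ∀ w : Word QGen, NullHomotopic QRels w →
      FFFLle QRels w (C * w.length) := by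
  refine ⟨40000, by norm_num, fun w hw => ?_⟩
  rcases w with _ | ⟨x, w⟩
  · exact ⟨0, fun _ => [[]], rfl, by simp, by simp, by simp [totalLength]⟩
  have h := hnnVal_map_letterSyl (x :: w)
  rw [lift_genVal_eq_one hw] at h
  have hlen : 1 ≤ (x :: w).length := by simp
  refine (Fills.of_homotopic (homotopic_real_map_letterSyl _ ?_)
    (fills_of_hnnVal_eq_one h ?_)).fFFLle
  · linarith
  · rw [wt_map_letterSyl]
    linarith
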